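/- There exists a constant c > 0 such that for all integers n, t ≥ 2, log₂ α([t]^n) ≤ (1 + c·(log₂ n)³/n) · N(t,n), where N(t,n) is the size of a largest layer of [t]^n, i.e. the maximum over integers k of the number of n-tuples x ∈ {0,…,t−1}^n with Σᵢ xᵢ = k. (Falgas-Ravry–Räty–Tomon theorem on antichains in [t]^n.) -/

import Mathlib

/-- The number of antichains in the poset `[t]^n` (n-tuples of elements of
`{0,…,t−1}` with the pointwise order). -/
noncomputable def alphaT (t n : ℕ) : ℕ :=
  Nat.card {A : Finset (Fin n → Fin t) // IsAntichain (· ≤ ·) (A : Set (Fin n → Fin t))}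

/-- The size of the `k`-th layer of `[t]^n`: the number of tuples whose coordinates
sum to `k`. -/
def layerSize (t n k : ℕ) : ℕ :=
  Fintype.card {x : Fin n → Fin t // ∑ i, (x i : ℕ) = k}

/-- `N(t,n)`: the maximum size of a layer of `[t]^n`.  (Every nonempty layer has
index at most `n·t`, so the sup below is the maximum over all integers `k`.) -/
def maxLayer (t n : ℕ) : ℕ :=
  (Finset.range (n * t + 1)).sup (fun k => layerSize t n k)

open Finset

/-- Number of `m`-tuples with entries in `{0,…,t-1}` and sum `k`, defined by convolution. -/
noncomputable def layerCount (t : ℕ) : ℕ → ℤ → ℝ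
  | 0, k => if k = 0 then 1 else 0
  | m + 1, k => ∑ i ∈ range t, layerCount t m (k - i)

theorem layerCount_succ (t m : ℕ) (k : ℤ) :
    layerCount t (m + 1) k = ∑ i ∈ range t, layerCount t m (k - i) := rfl

theorem layerCount_nonneg (t m : ℕ) (k : ℤ) : 0 ≤ layerCount t m k := by
  induction m generalizing k with
  | zero => simp only [layerCount]; split_ifs <;> norm_num
  | succ m ih => exact sum_nonneg fun i _ => ih _

theorem layerCount_of_neg (t m : ℕ) {k : ℤ} (hk : k < 0) : layerCount t m k = 0 := by
  induction m generalizing k with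
  | zero => simp only [layerCount]; rw [if_neg (by omega)]
  | succ m ih => exact sum_eq_zero fun i _ => ih (by omega)

theorem layerCount_symm (t m : ℕ) (k : ℤ) :
    layerCount t m (m * ((t : ℤ) - 1) - k) = layerCount t m k := by
  induction m generalizing k with
  | zero => simp [layerCount]
  | succ m ih =>
    rw [layerCount_succ, layerCount_succ, ← sum_range_reflect]
    refine sum_congr rfl fun i hi => ?_
    rw [mem_range] at hi
    rw [← ih (k - i)]
    congr 1
    have : ((t - 1 - i : ℕ) : ℤ) = t - 1 - i := by omega
    rw [this]; push_cast; ring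

theorem layerCount_of_gt (t m : ℕ) {k : ℤ} (hk : m * ((t : ℤ) - 1) < k) :
    layerCount t m k = 0 := by
  rw [← layerCount_symm]; exact layerCount_of_neg _ _ (by linarith)

theorem layerCount_pos {t m : ℕ} (ht : 1 ≤ t) {k : ℤ} (h0 : 0 ≤ k)
    (h1 : k ≤ m * ((t : ℤ) - 1)) : 0 < layerCount t m k := by
  induction m generalizing k with
  | zero => have : k = 0 := by simp at h1; omega
            simp [layerCount, this]
  | succ m ih =>
    rw [layerCount_succ]
    have hm : 0 ≤ (m : ℤ) * ((t : ℤ) - 1) := mul_nonneg (by positivity) (by omega)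
    push_cast at h1
    rw [add_mul, one_mul] at h1
    by_cases hk : k ≤ (t : ℤ) - 1
    · refine sum_pos' (fun i _ => layerCount_nonneg _ _ _) ⟨k.toNat, ?_, ih ?_ ?_⟩
      · rw [mem_range]; omega
      · omega
      · omega
    · refine sum_pos' (fun i _ => layerCount_nonneg _ _ _) ⟨t - 1, ?_, ih ?_ ?_⟩
      · rw [mem_range]; omega
      · omega
      · omega

/-- Log-concavity in the form that also covers gaps in the support. -/
def LogConcaveSeq (f : ℤ → ℝ) : Prop :=
  ∀ u' u v v' : ℤ, u' ≤ u → u' ≤ v → u + v = u' + v' → f u' * f v' ≤ f u * f v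

theorem logConcaveSeq_of_adjacent {f : ℤ → ℝ}
    (h : ∀ x y : ℤ, x ≤ y → f (x - 1) * f (y + 1) ≤ f x * f y) : LogConcaveSeq f := by
  have key : ∀ (d : ℕ) (u v : ℤ), u ≤ v → f (u - d) * f (v + d) ≤ f u * f v := by
    intro d
    induction d with
    | zero => intro u v _; simp
    | succ d ih =>
      intro u v huv
      refine le_trans ?_ (ih u v huv)
      rw [show u - ((d + 1 : ℕ) : ℤ) = u - d - 1 by omega,
        show v + ((d + 1 : ℕ) : ℤ) = v + d + 1 by omega]
      exact h (u - d) (v + d) (by omega)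
  intro u' u v v' h1 h2 h3
  rcases le_total u v with huv | huv
  · have := key (u - u').toNat u v huv
    convert this using 3 <;> omega
  · have := key (v - u').toNat v u huv
    rw [mul_comm (f u)]
    convert this using 3 <;> omega

theorem LogConcaveSeq.window_sum {f : ℤ → ℝ} (hf : LogConcaveSeq f) (t : ℕ) :
    LogConcaveSeq fun k => ∑ i ∈ range t, f (k - i) := by
  refine logConcaveSeq_of_adjacent fun x y hxy => ?_
  rcases t with _ | T
  · simp
  have e1 : ∀ z : ℤ, ∑ i ∈ range (T + 1), f (z - i) = ∑ i ∈ range T, f (z - 1 - i) + f z := by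
    intro z
    rw [sum_range_succ']
    congr 1
    · refine sum_congr rfl fun i _ => ?_
      congr 1; push_cast; ring
    · simp
  have e2 : ∀ z : ℤ, ∑ i ∈ range (T + 1), f (z - i) = ∑ i ∈ range T, f (z - i) + f (z - T) :=
    fun z => sum_range_succ _ _
  rw [e2 (x - 1), e1 (y + 1), e1 x, e2 y]
  simp only [add_sub_cancel_right]
  have h1 : (∑ i ∈ range T, f (x - 1 - i)) * f (y + 1) ≤ f x * ∑ i ∈ range T, f (y - i) := by
    rw [sum_mul, mul_sum]
    exact sum_le_sum fun i _ => hf _ _ _ _ (by omega) (by rw [mem_range] at *; omega) (by ring)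
  have h2 : f (x - 1 - T) * (∑ i ∈ range T, f (y - i)) ≤
      (∑ i ∈ range T, f (x - 1 - i)) * f (y - T) := by
    rw [sum_mul, mul_sum]
    exact sum_le_sum fun i _ => hf _ _ _ _ (by rw [mem_range] at *; omega) (by omega) (by ring)
  have h3 : f (x - 1 - T) * f (y + 1) ≤ f x * f (y - T) :=
    hf _ _ _ _ (by omega) (by omega) (by ring)
  nlinarith

theorem layerCount_logConcave (t m : ℕ) : LogConcaveSeq (layerCount t m) := by
  induction m with
  | zero =>
    intro u' u v v' h1 h2 h3
    simp only [layerCount]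
    split_ifs <;> first | (exfalso; omega) | norm_num
  | succ m ih => exact ih.window_sum t

/-- By symmetry, the mean of one coordinate on layer `k` of `[t]^(m+1)` is `k/(m+1)`. -/
theorem layerCount_mean (t m : ℕ) (k : ℤ) :
    (m + 1) * ∑ i ∈ range t, (i : ℝ) * layerCount t m (k - i) = k * layerCount t (m + 1) k := by
  induction m generalizing k with
  | zero =>
    simp only [layerCount, mul_sum]
    refine sum_congr rfl fun i _ => ?_
    by_cases h : k - i = 0
    · have : (k : ℝ) = i := by exact_mod_cast (by omega : k = (i : ℤ))
      simp [h, this]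
    · simp [h]
  | succ m ih =>
    have h1 : ∑ i ∈ range t, ((k : ℝ) - i) * layerCount t (m + 1) (k - i) =
        (m + 1) * ∑ j ∈ range t, (j : ℝ) * layerCount t (m + 1) (k - j) := by
      have : ∀ i ∈ range t, ((k : ℝ) - i) * layerCount t (m + 1) (k - i) =
          (m + 1) * ∑ j ∈ range t, (j : ℝ) * layerCount t m (k - i - j) := by
        intro i _
        rw [ih (k - i)]; push_cast; ring
      rw [sum_congr rfl this, ← mul_sum, sum_comm]
      congr 1
      refine sum_congr rfl fun j _ => ?_
      rw [layerCount_succ, mul_sum]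
      refine sum_congr rfl fun i _ => ?_
      congr 2; ring
    have h2 : (k : ℝ) * layerCount t (m + 2) k =
        ∑ i ∈ range t, (i : ℝ) * layerCount t (m + 1) (k - i) +
        ∑ i ∈ range t, ((k : ℝ) - i) * layerCount t (m + 1) (k - i) := by
      rw [layerCount_succ t (m + 1), mul_sum, ← sum_add_distrib]
      exact sum_congr rfl fun i _ => by ring
    rw [h2, h1]; push_cast; ring

/-- Sum of `layerCount t m` over the window of length `v` ending at `k`. -/
noncomputable def cumCount (t m : ℕ) (k : ℤ) (v : ℕ) : ℝ :=
  ∑ j ∈ range v, layerCount t m (k - j)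

/-- The fraction of the flow leaving a point of layer `k` of `[t]^m × [t]` with last
coordinate `v` that increases the last coordinate. -/
noncomputable def share (t m v : ℕ) (k : ℤ) : ℝ :=
  (cumCount t m k (v + 1) - cumCount t m (k + 1) (v + 1) *
    (layerCount t (m + 1) k / layerCount t (m + 1) (k + 1))) / layerCount t m (k - v)

theorem cumCount_self (t m : ℕ) (k : ℤ) : cumCount t m k t = layerCount t (m + 1) k := rfl

theorem cumCount_succ (t m : ℕ) (k : ℤ) (v : ℕ) :
    cumCount t m k (v + 1) = cumCount t m k v + layerCount t m (k - v) := sum_range_succ _ _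

theorem cumCount_add_one_succ (t m : ℕ) (k : ℤ) (v : ℕ) :
    cumCount t m (k + 1) (v + 1) = cumCount t m k v + layerCount t m (k + 1) := by
  unfold cumCount
  rw [sum_range_succ']
  congr 1
  · refine sum_congr rfl fun i _ => ?_
    congr 1; push_cast; ring
  · simp

theorem cumCount_mono (t m : ℕ) (k : ℤ) : Monotone (cumCount t m k) := fun _ _ h =>
  sum_le_sum_of_subset_of_nonneg (range_mono h) fun _ _ _ => layerCount_nonneg _ _ _

theorem cumCount_nonneg (t m : ℕ) (k : ℤ) (v : ℕ) : 0 ≤ cumCount t m k v :=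
  sum_nonneg fun _ _ => layerCount_nonneg _ _ _

theorem cross_sum_le (t m : ℕ) (k : ℤ) (A B : Finset ℕ) (h : ∀ a ∈ A, ∀ b ∈ B, a < b) :
    (∑ a ∈ A, layerCount t m (k + 1 - a)) * ∑ b ∈ B, layerCount t m (k - b) ≤
      (∑ b ∈ B, layerCount t m (k + 1 - b)) * ∑ a ∈ A, layerCount t m (k - a) := by
  rw [sum_mul_sum, sum_mul_sum, sum_comm]
  refine sum_le_sum fun b hb => sum_le_sum fun a ha => ?_
  have := h a ha b hb
  rw [mul_comm]
  exact layerCount_logConcave t m _ _ _ _ (by omega) (by omega) (by ring)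

theorem cumCount_add_Ico (t m : ℕ) (k : ℤ) {i j : ℕ} (h : i ≤ j) :
    cumCount t m k j = cumCount t m k i + ∑ a ∈ Ico i j, layerCount t m (k - a) :=
  (sum_range_add_sum_Ico _ h).symm

theorem cumCount_cross (t m : ℕ) (k : ℤ) {i j : ℕ} (h : i ≤ j) :
    cumCount t m (k + 1) i * cumCount t m k j ≤ cumCount t m (k + 1) j * cumCount t m k i := by
  rw [cumCount_add_Ico t m k h, cumCount_add_Ico t m (k + 1) h]
  have := cross_sum_le t m k (range i) (Ico i j) fun a ha b hb => by
    rw [mem_range] at ha; rw [mem_Ico] at hb; omega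
  unfold cumCount
  nlinarith

theorem cumCount_cross_tail (t m : ℕ) (k : ℤ) {i j l : ℕ} (h : i ≤ j) (hl : j ≤ l) :
    (cumCount t m (k + 1) l - cumCount t m (k + 1) i) * (cumCount t m k l - cumCount t m k j) ≤
    (cumCount t m (k + 1) l - cumCount t m (k + 1) j) *
      (cumCount t m k l - cumCount t m k i) := by
  have := cross_sum_le t m k (Ico i j) (Ico j l) fun a ha b hb => by
    rw [mem_Ico] at ha hb; omega
  rw [cumCount_add_Ico t m k hl, cumCount_add_Ico t m (k + 1) hl, cumCount_add_Ico t m k h,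
    cumCount_add_Ico t m (k + 1) h]
  nlinarith

section Share

variable {t m : ℕ} {k : ℤ}

theorem share_nonneg (h1 : 0 < layerCount t (m + 1) (k + 1)) {v : ℕ} (hv : v < t) :
    0 ≤ share t m v k := by
  refine div_nonneg ?_ (layerCount_nonneg _ _ _)
  have := cumCount_cross t m k (Nat.succ_le_of_lt hv)
  rw [cumCount_self, cumCount_self] at this
  rw [sub_nonneg, ← mul_div_assoc, div_le_iff₀ h1]
  linarith

theorem share_le_one (h1 : 0 < layerCount t (m + 1) (k + 1)) {v : ℕ} (hv : v < t) :
    share t m v k ≤ 1 := by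
  refine div_le_one_of_le₀ ?_ (layerCount_nonneg _ _ _)
  have hb := layerCount_nonneg t m (k + 1)
  have hM := cumCount_nonneg t m k v
  have hMa : cumCount t m k v ≤ layerCount t (m + 1) k := cumCount_mono t m k hv.le
  have ha : layerCount t (m + 1) (k + 1) ≤ layerCount t (m + 1) k + layerCount t m (k + 1) := by
    rw [← cumCount_self, ← cumCount_self, ← cumCount_add_one_succ]
    exact cumCount_mono _ _ _ (Nat.le_succ t)
  rw [cumCount_succ, cumCount_add_one_succ]
  have : cumCount t m k v ≤ (cumCount t m k v + layerCount t m (k + 1)) *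
      (layerCount t (m + 1) k / layerCount t (m + 1) (k + 1)) := by
    rw [← mul_div_assoc, le_div_iff₀ h1]
    nlinarith
  linarith

theorem share_top (ht : 1 ≤ t) (h1 : 0 < layerCount t (m + 1) (k + 1)) :
    share t m (t - 1) k = 0 := by
  unfold share
  rw [Nat.sub_add_cancel ht, cumCount_self, cumCount_self, mul_div_cancel₀ _ h1.ne', sub_self,
    zero_div]

theorem share_eq_one_of_full (ht : 1 ≤ t) {v : ℕ} (hk : k - v = m * ((t : ℤ) - 1)) :
    share t m v k = 1 := by
  unfold share
  have h0 : ∀ j : ℤ, (j : ℤ) ≤ v → layerCount t m (k + 1 - j) = 0 := fun j hj =>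
    layerCount_of_gt _ _ (by omega)
  have e1 : cumCount t m (k + 1) (v + 1) = 0 :=
    sum_eq_zero fun j hj => h0 j (by rw [mem_range] at hj; omega)
  have e2 : cumCount t m k v = 0 := sum_eq_zero fun j hj => by
    rw [mem_range] at hj
    have := h0 (j + 1) (by omega)
    rwa [show k + 1 - ((j : ℤ) + 1) = k - j by ring] at this
  rw [cumCount_succ, e1, e2, zero_mul, sub_zero, zero_add]
  exact div_self (layerCount_pos ht (by rw [hk]; exact mul_nonneg (by positivity) (by omega))
    hk.le).ne'

theorem share_balance {v : ℕ} (hv : v < t) (hb : 0 < layerCount t m (k + 1 - v))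
    (h1 : 0 < layerCount t (m + 1) (k + 1)) :
    (if v = 0 then 0 else share t m (v - 1) k) +
      (1 - share t m v k) * (layerCount t m (k - v) / layerCount t m (k + 1 - v)) =
    layerCount t (m + 1) k / layerCount t (m + 1) (k + 1) := by
  set ρ := layerCount t (m + 1) k / layerCount t (m + 1) (k + 1) with hρ
  have e1 : (if v = 0 then 0 else share t m (v - 1) k) =
      (cumCount t m k v - cumCount t m (k + 1) v * ρ) / layerCount t m (k + 1 - v) := by
    split_ifs with h
    · subst h; simp [cumCount]
    · unfold share
      rw [Nat.sub_add_cancel (by omega), show k - ((v - 1 : ℕ) : ℤ) = k + 1 - v by omega]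
  have e2 : (1 - share t m v k) * layerCount t m (k - v) =
      layerCount t m (k - v) - (cumCount t m k (v + 1) - cumCount t m (k + 1) (v + 1) * ρ) := by
    unfold share
    rw [← hρ]
    by_cases h : layerCount t m (k - v) = 0
    · have hk : k < v := by
        by_contra hcon
        push Not at hcon
        have h2 : (k + 1 - v) ≤ m * ((t : ℤ) - 1) := by
          by_contra h3
          push Not at h3
          exact hb.ne' (layerCount_of_gt _ _ h3)
        exact (layerCount_pos (by omega) (by omega) (by omega)).ne' h
      have hk1 : 0 ≤ k + 1 - v := by
        by_contra h3
        push Not at h3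
        exact hb.ne' (layerCount_of_neg _ _ h3)
      have hfull : ∀ z : ℤ, z ≤ k + 1 → cumCount t m z (v + 1) = layerCount t (m + 1) z := by
        intro z hz
        rw [← cumCount_self, cumCount_add_Ico t m z (Nat.succ_le_of_lt hv), sum_eq_zero, add_zero]
        intro a ha
        rw [mem_Ico] at ha
        exact layerCount_of_neg _ _ (by omega)
      rw [hfull k (by omega), hfull (k + 1) le_rfl, hρ, mul_div_cancel₀ _ h1.ne', h]
      ring
    · field_simp
  rw [e1, ← mul_div_assoc (1 - share t m v k), e2, ← add_div, div_eq_iff hb.ne', cumCount_succ t m k,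
    cumCount_succ t m (k + 1)]
  ring

theorem sum_cumCount (t m : ℕ) (k : ℤ) :
    ∑ v ∈ range t, cumCount t m k (v + 1) = (t - k / (m + 1)) * layerCount t (m + 1) k := by
  have h1 : ∀ s : ℕ, ∑ v ∈ range s, cumCount t m k (v + 1) =
      ∑ j ∈ range s, ((s : ℝ) - j) * layerCount t m (k - j) := by
    intro s
    induction s with
    | zero => simp
    | succ s ih =>
      rw [sum_range_succ, ih, sum_range_succ, cumCount_succ]
      unfold cumCount
      rw [← add_assoc, ← sum_add_distrib]
      congr 1
      · exact sum_congr rfl fun i _ => by push_cast; ring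
      · push_cast; ring
  rw [h1]
  simp only [sub_mul, sum_sub_distrib]
  rw [← mul_sum, ← layerCount_succ]
  have := layerCount_mean t m k
  have hm : (0 : ℝ) < m + 1 := by positivity
  rw [div_mul_eq_mul_div, ← this]
  field_simp

theorem share_le_of_flat (ht : 2 ≤ t) (h0 : 0 < layerCount t (m + 1) k)
    (h1 : 0 < layerCount t (m + 1) (k + 1)) {K : ℝ} (hK : 0 < K)
    (hflat : ∀ i < t, ∀ j < t, layerCount t m (k - i) ≤ K * layerCount t m (k - j))
    {v : ℕ} (hv : v < t) : share t m v k ≤ 8 * K ^ 2 / (m + 1) := by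
  set a := layerCount t (m + 1) k with ha
  set a' := layerCount t (m + 1) (k + 1) with ha'
  have htR : (2 : ℝ) ≤ t := by exact_mod_cast ht
  have hlow : ∀ j < t, a ≤ t * K * layerCount t m (k - j) := by
    intro j hj
    calc a = ∑ i ∈ range t, layerCount t m (k - i) := rfl
      _ ≤ ∑ i ∈ range t, K * layerCount t m (k - j) :=
        sum_le_sum fun i hi => hflat i (mem_range.1 hi) j hj
      _ = t * K * layerCount t m (k - j) := by simp; ring
  have hbpos : ∀ j < t, 0 < layerCount t m (k - j) := by
    intro j hj
    have := hlow j hj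
    by_contra hcon
    push Not at hcon
    have : t * K * layerCount t m (k - j) ≤ 0 :=
      mul_nonpos_of_nonneg_of_nonpos (by positivity) hcon
    linarith
  let R : ℕ → ℝ := fun j => cumCount t m k (j + 1) / a - cumCount t m (k + 1) (j + 1) / a'
  have hR : ∀ j < t, 0 ≤ R j := by
    intro j hj
    have := cumCount_cross t m k (Nat.succ_le_of_lt hj)
    rw [cumCount_self, cumCount_self] at this
    simp only [R]
    rw [sub_nonneg, div_le_div_iff₀ h1 h0]
    linarith
  have hsum : ∑ j ∈ range t, R j = 1 / (m + 1) := by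
    simp only [R]
    rw [sum_sub_distrib, ← sum_div, ← sum_div, sum_cumCount, sum_cumCount, ← ha, ← ha',
      mul_div_cancel_right₀ _ h0.ne', mul_div_cancel_right₀ _ h1.ne']
    push_cast; field_simp; ring
  have hcumlow : ∀ i j, i ≤ j → j ≤ t →
      ((j : ℝ) - i) * a ≤ t * K * (cumCount t m k j - cumCount t m k i) := by
    intro i j hij hj
    rw [cumCount_add_Ico t m k hij, add_sub_cancel_left, mul_sum]
    calc ((j : ℝ) - i) * a = ∑ _l ∈ Ico i j, a := by
          rw [sum_const, Nat.card_Ico, nsmul_eq_mul, Nat.cast_sub hij]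
      _ ≤ _ := sum_le_sum fun l hl => hlow l (by rw [mem_Ico] at hl; omega)
  have hRlow : ∀ j < t, R v * (((j : ℝ) + 1) * (t - 1 - j)) ≤ R j * (t ^ 2 * K) := by
    intro j hj
    have hjt : (j : ℝ) + 1 ≤ t := by exact_mod_cast hj
    have hRv := hR v hv
    rcases le_total j v with hjv | hjv
    · have hc := cumCount_cross t m k (Nat.succ_le_succ hjv)
      have h2 : R v * cumCount t m k (j + 1) ≤ R j * cumCount t m k (v + 1) := by
        simp only [R]
        have : cumCount t m (k + 1) (j + 1) / a' * cumCount t m k (v + 1) ≤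
            cumCount t m (k + 1) (v + 1) / a' * cumCount t m k (j + 1) := by
          rw [div_mul_eq_mul_div, div_mul_eq_mul_div]
          exact div_le_div_of_nonneg_right hc h1.le
        have e : cumCount t m k (v + 1) / a * cumCount t m k (j + 1) =
          cumCount t m k (j + 1) / a * cumCount t m k (v + 1) := by ring
        linarith
      have h3 : cumCount t m k (v + 1) ≤ a := cumCount_mono t m k (Nat.succ_le_of_lt hv)
      have h4 := hcumlow 0 (j + 1) (Nat.zero_le _) hj
      have h5 : cumCount t m k 0 = 0 := rfl
      rw [h5] at h4
      push_cast at h4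
      have h6 : R v * ((j : ℝ) + 1) * a ≤ R j * (t * K) * a := by
        calc R v * ((j : ℝ) + 1) * a = R v * (((j : ℝ) + 1 - 0) * a) := by ring
          _ ≤ R v * (t * K * (cumCount t m k (j + 1) - 0)) := mul_le_mul_of_nonneg_left h4 hRv
          _ = t * K * (R v * cumCount t m k (j + 1)) := by ring
          _ ≤ t * K * (R j * cumCount t m k (v + 1)) :=
            mul_le_mul_of_nonneg_left h2 (by positivity)
          _ ≤ t * K * (R j * a) := mul_le_mul_of_nonneg_left
            (mul_le_mul_of_nonneg_left h3 (hR j hj)) (by positivity)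
          _ = _ := by ring
      have h7 := le_of_mul_le_mul_right h6 h0
      calc R v * (((j : ℝ) + 1) * (t - 1 - j)) = R v * ((j : ℝ) + 1) * (t - 1 - j) := by ring
        _ ≤ R v * ((j : ℝ) + 1) * t :=
          mul_le_mul_of_nonneg_left (by linarith [(Nat.cast_nonneg j : (0 : ℝ) ≤ j)])
            (by positivity)
        _ ≤ R j * (t * K) * t := mul_le_mul_of_nonneg_right h7 (by positivity)
        _ = _ := by ring
    · have hc := cumCount_cross_tail t m k (Nat.succ_le_succ hjv) (Nat.succ_le_of_lt hj)
      rw [cumCount_self, cumCount_self, ← ha, ← ha'] at hc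
      simp only [Nat.succ_eq_add_one] at hc
      have eR : ∀ i, R i = (a' - cumCount t m (k + 1) (i + 1)) / a' -
          (a - cumCount t m k (i + 1)) / a := by
        intro i
        simp only [R]
        field_simp
        ring
      have h2 : R v * (a - cumCount t m k (j + 1)) ≤ R j * (a - cumCount t m k (v + 1)) := by
        rw [eR, eR]
        have : (a' - cumCount t m (k + 1) (v + 1)) / a' * (a - cumCount t m k (j + 1)) ≤
            (a' - cumCount t m (k + 1) (j + 1)) / a' * (a - cumCount t m k (v + 1)) := by
          rw [div_mul_eq_mul_div, div_mul_eq_mul_div]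
          exact div_le_div_of_nonneg_right hc h1.le
        have e : (a - cumCount t m k (v + 1)) / a * (a - cumCount t m k (j + 1)) =
          (a - cumCount t m k (j + 1)) / a * (a - cumCount t m k (v + 1)) := by ring
        linarith
      have h3 : a - cumCount t m k (v + 1) ≤ a := by linarith [cumCount_nonneg t m k (v + 1)]
      have h4 := hcumlow (j + 1) t hj le_rfl
      rw [cumCount_self, ← ha] at h4
      push_cast at h4
      have h6 : R v * ((t : ℝ) - 1 - j) * a ≤ R j * (t * K) * a := by
        calc R v * ((t : ℝ) - 1 - j) * a = R v * (((t : ℝ) - (j + 1)) * a) := by ring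
          _ ≤ R v * (t * K * (a - cumCount t m k (j + 1))) := mul_le_mul_of_nonneg_left h4 hRv
          _ = t * K * (R v * (a - cumCount t m k (j + 1))) := by ring
          _ ≤ t * K * (R j * (a - cumCount t m k (v + 1))) :=
            mul_le_mul_of_nonneg_left h2 (by positivity)
          _ ≤ t * K * (R j * a) := mul_le_mul_of_nonneg_left
            (mul_le_mul_of_nonneg_left h3 (hR j hj)) (by positivity)
          _ = _ := by ring
      have h7 := le_of_mul_le_mul_right h6 h0
      calc R v * (((j : ℝ) + 1) * (t - 1 - j)) = R v * ((t : ℝ) - 1 - j) * (j + 1) := by ring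
        _ ≤ R v * ((t : ℝ) - 1 - j) * t :=
          mul_le_mul_of_nonneg_left hjt (mul_nonneg hRv (by linarith))
        _ ≤ R j * (t * K) * t := mul_le_mul_of_nonneg_right h7 (by positivity)
        _ = _ := by ring
  have hpoly : ∑ j ∈ range t, (((j : ℝ) + 1) * (t - 1 - j)) = (t + 1) * t * (t - 1) / 6 := by
    have : ∀ (s : ℕ) (c : ℝ), ∑ j ∈ range s, (((j : ℝ) + 1) * (c - 1 - j)) =
        s * (s + 1) * (3 * c - 2 * s - 1) / 6 := by
      intro s c
      induction s with
      | zero => simp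
      | succ s ih => rw [sum_range_succ, ih]; push_cast; ring
    rw [this]; ring
  have hfin : R v * ((t + 1) * t * (t - 1) / 6) ≤ 1 / (m + 1) * (t ^ 2 * K) := by
    rw [← hpoly, ← hsum, mul_sum, sum_mul]
    exact sum_le_sum fun j hj => hRlow j (mem_range.1 hj)
  have hRv8 : R v * t ≤ 8 * K / (m + 1) := by
    have h2 : R v * (t ^ 2 * t / 8) ≤ R v * ((t + 1) * t * (t - 1) / 6) :=
      mul_le_mul_of_nonneg_left (by nlinarith) (hR v hv)
    have h3 : (R v * t) * t ^ 2 ≤ (8 * K / (m + 1)) * t ^ 2 := by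
      calc (R v * t) * t ^ 2 = 8 * (R v * (t ^ 2 * t / 8)) := by ring
        _ ≤ 8 * (1 / (m + 1) * (t ^ 2 * K)) := by linarith
        _ = _ := by ring
    exact le_of_mul_le_mul_right h3 (by positivity)
  have hshare : share t m v k = R v * (a / layerCount t m (k - v)) := by
    simp only [R, share, ← ha, ← ha']
    have := (hbpos v hv).ne'
    field_simp
  have hab : a / layerCount t m (k - v) ≤ t * K := by
    rw [div_le_iff₀ (hbpos v hv)]; exact hlow v hv
  calc share t m v k ≤ R v * (t * K) := by
        rw [hshare]; exact mul_le_mul_of_nonneg_left hab (hR v hv)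
    _ = (R v * t) * K := by ring
    _ ≤ (8 * K / (m + 1)) * K := mul_le_mul_of_nonneg_right hRv8 hK.le
    _ = _ := by ring

end Share

theorem layerCount_step_down (t m : ℕ) (j : ℤ) {d : ℕ} (hd : 1 ≤ d) :
    layerCount t (m + 1) j * (j / (m + 1) - (d - 1)) ≤ t * layerCount t (m + 1) (j - d) := by
  have hmean := layerCount_mean t m j
  have hm : (0 : ℝ) < m + 1 := by positivity
  have e1 : layerCount t (m + 1) j * (j / (m + 1) - (d - 1)) =
      ∑ i ∈ range t, ((i : ℝ) - (d - 1)) * layerCount t m (j - i) := by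
    simp only [sub_mul _ ((d : ℝ) - 1), sum_sub_distrib]
    rw [← mul_sum, ← layerCount_succ, mul_sub, mul_comm _ ((d : ℝ) - 1)]
    congr 1
    rw [mul_div_assoc', mul_comm _ (j : ℝ), ← hmean]
    field_simp
  have e2 : ∀ i ∈ range t, ((i : ℝ) - (d - 1)) * layerCount t m (j - i) ≤
      if d ≤ i then t * layerCount t m (j - i) else 0 := by
    intro i hi
    rw [mem_range] at hi
    have hb := layerCount_nonneg t m (j - i)
    have hd' : (1 : ℝ) ≤ d := by exact_mod_cast hd
    have hi' : (i : ℝ) ≤ t := by exact_mod_cast hi.le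
    split_ifs with h
    · exact mul_le_mul_of_nonneg_right (by linarith) hb
    · have : (i : ℝ) + 1 ≤ d := by exact_mod_cast (by omega : i + 1 ≤ d)
      exact mul_nonpos_of_nonpos_of_nonneg (by linarith) hb
  rw [e1]
  refine (sum_le_sum e2).trans ?_
  rw [← sum_filter, ← mul_sum]
  refine mul_le_mul_of_nonneg_left ?_ (by positivity)
  have e3 : (range t).filter (fun i => d ≤ i) = Ico d t := by
    ext i; simp only [mem_filter, mem_range, mem_Ico]; omega
  rw [e3, sum_Ico_eq_sum_range, layerCount_succ]
  refine (sum_le_sum_of_subset_of_nonneg (range_mono (Nat.sub_le t d))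
    fun _ _ _ => layerCount_nonneg _ _ _).trans (le_of_eq ?_)
  refine sum_congr rfl fun i _ => ?_
  congr 1; push_cast; ring

theorem layerCount_flat_down {t : ℕ} (ht : 1 ≤ t) (m r : ℕ) (j : ℤ) {d : ℕ}
    (hd : d ≤ r * (t / 32 + 1)) (hj : ((m : ℝ) + 1) * t / 16 ≤ j - d) :
    layerCount t (m + 1) j ≤ 32 ^ r * layerCount t (m + 1) (j - d) := by
  induction r generalizing j d with
  | zero =>
    have : d = 0 := by omega
    subst this; simp
  | succ r ih =>
    have htR : (0 : ℝ) < t := by exact_mod_cast ht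
    obtain ⟨d1, d2, rfl, h1, h2⟩ : ∃ d1 d2, d = d1 + d2 ∧ d1 ≤ t / 32 + 1 ∧
        d2 ≤ r * (t / 32 + 1) := by
      refine ⟨min d (t / 32 + 1), d - min d (t / 32 + 1), by omega, min_le_right _ _, ?_⟩
      rw [add_mul, one_mul] at hd; omega
    push_cast at hj
    have h3 : layerCount t (m + 1) j ≤ 32 * layerCount t (m + 1) (j - d1) := by
      rcases Nat.eq_zero_or_pos d1 with h0 | h0
      · subst h0
        have := layerCount_nonneg t (m + 1) j
        simp only [Nat.cast_zero, sub_zero]; linarith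
      · have hs := layerCount_step_down t m j h0
        have hm : (0 : ℝ) < m + 1 := by positivity
        have hA : (t : ℝ) / 16 ≤ j / (m + 1) := by
          rw [le_div_iff₀ hm]
          have : (0 : ℝ) ≤ d1 + d2 := by positivity
          nlinarith
        have hB : (d1 : ℝ) - 1 ≤ t / 32 := by
          have : ((d1 - 1 : ℕ) : ℝ) ≤ ((t / 32 : ℕ) : ℝ) := by exact_mod_cast (by omega)
          rw [Nat.cast_sub h0] at this
          refine le_trans (by simpa using this) ?_
          exact_mod_cast Nat.cast_div_le (α := ℝ) (m := t) (n := 32)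
        have h4 : layerCount t (m + 1) j * (t / 32) ≤ t * layerCount t (m + 1) (j - d1) :=
          (mul_le_mul_of_nonneg_left (by linarith) (layerCount_nonneg _ _ _)).trans hs
        have h5 : layerCount t (m + 1) j * t ≤ 32 * layerCount t (m + 1) (j - d1) * t := by
          linarith
        exact le_of_mul_le_mul_right h5 htR
    have h4 := ih (j - d1) h2 (by push_cast; linarith)
    rw [pow_succ, show j - ((d1 + d2 : ℕ) : ℤ) = j - d1 - d2 by push_cast; ring]
    linarith

/-- The constant in the bound on shares in the middle layers. -/
noncomputable def shareConst : ℝ := 8 * (32 ^ 32) ^ 2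

theorem layerCount_flat {t m : ℕ} (ht : 2 ≤ t) (hm : 14 ≤ m) {k : ℤ}
    (hk : |(k : ℝ) - (m + 1) * (t - 1) / 2| ≤ (m + 1) * t / 8) {i j : ℕ} (hi : i < t)
    (hj : j < t) : layerCount t m (k - i) ≤ 32 ^ 32 * layerCount t m (k - j) := by
  obtain ⟨m, rfl⟩ : ∃ m', m = m' + 1 := ⟨m - 1, by omega⟩
  have htR : (2 : ℝ) ≤ t := by exact_mod_cast ht
  have hmR : (14 : ℝ) ≤ m + 1 := by exact_mod_cast hm
  have hjR : (j : ℝ) ≤ t := by exact_mod_cast hj.le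
  have hj0 : (0 : ℝ) ≤ j := by positivity
  rw [abs_le] at hk
  push_cast at hk
  obtain ⟨hk1, hk2⟩ := hk
  have hmt := mul_nonneg (sub_nonneg.2 hmR) (sub_nonneg.2 htR)
  rcases le_total i j with hij | hij
  · have := layerCount_flat_down (by omega : 1 ≤ t) m 32 (k - i) (d := j - i) (by omega) (by
      rw [Nat.cast_sub hij]; push_cast; nlinarith)
    rwa [show k - (i : ℤ) - ((j - i : ℕ) : ℤ) = k - j by omega] at this
  · rw [← layerCount_symm t (m + 1) (k - i), ← layerCount_symm t (m + 1) (k - j)]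
    have := layerCount_flat_down (by omega : 1 ≤ t) m 32
      (((m + 1 : ℕ) : ℤ) * ((t : ℤ) - 1) - (k - i)) (d := i - j) (by omega) (by
      rw [Nat.cast_sub hij]; push_cast; nlinarith)
    rwa [show ((m + 1 : ℕ) : ℤ) * ((t : ℤ) - 1) - (k - i) - ((i - j : ℕ) : ℤ) =
      ((m + 1 : ℕ) : ℤ) * ((t : ℤ) - 1) - (k - j) by omega] at this

theorem share_le_middle {t m : ℕ} (ht : 2 ≤ t) {k : ℤ} (hk0 : 0 ≤ k)
    (hk1 : k + 1 ≤ (m + 1 : ℕ) * ((t : ℤ) - 1))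
    (hk : |(k : ℝ) - (m + 1) * (t - 1) / 2| ≤ (m + 1) * t / 8) {v : ℕ} (hv : v < t) :
    share t m v k ≤ shareConst / (m + 1) := by
  have h1 : 0 < layerCount t (m + 1) (k + 1) := layerCount_pos (by omega) (by omega) hk1
  have h0 : 0 < layerCount t (m + 1) k := layerCount_pos (by omega) hk0 (by omega)
  rcases lt_or_ge m 14 with hm | hm
  · refine (share_le_one h1 hv).trans ?_
    rw [le_div_iff₀ (by positivity)]
    have : (m : ℝ) < 14 := by exact_mod_cast hm
    unfold shareConst
    norm_num
    linarith
  · exact share_le_of_flat ht h0 h1 (by positivity)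
      (fun i hi j hj => layerCount_flat ht hm hk hi hj) hv

section Flow

variable {ι : Type*} {t : ℕ}

theorem sum_le_card_mul {S : Finset ι} {x : ι → ℕ} (hx : ∀ l ∈ S, x l < t) :
    ∑ j ∈ S, (x j : ℤ) ≤ #S * ((t : ℤ) - 1) := by
  rw [← nsmul_eq_mul]
  exact sum_le_card_nsmul _ _ _ fun l hl => by have := hx l hl; omega

theorem layerCount_sum_pos (ht : 1 ≤ t) {S : Finset ι} {x : ι → ℕ} (hx : ∀ l ∈ S, x l < t) :
    0 < layerCount t #S (∑ j ∈ S, (x j : ℤ)) :=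
  layerCount_pos ht (by positivity) (sum_le_card_mul hx)

theorem layerCount_sum_add_one_pos (ht : 1 ≤ t) {m : ℕ} {S : Finset ι} {x : ι → ℕ}
    (hk : ∑ j ∈ S, (x j : ℤ) < m * ((t : ℤ) - 1)) :
    0 < layerCount t m (∑ j ∈ S, (x j : ℤ) + 1) :=
  layerCount_pos ht (by positivity) hk

variable [DecidableEq ι]

/-- The fraction of the flow leaving the point `x` of `[t]^S`, where `S` has `m` elements, in
the direction of coordinate `i`. -/
noncomputable def flow (t : ℕ) : ℕ → Finset ι → (ι → ℕ) → ι → ℝ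
  | 0, _, _, _ => 0
  | m + 1, S, x, i => (∑ l ∈ S, if i = l then share t m (x l) (∑ j ∈ S, (x j : ℤ)) else
      (1 - share t m (x l) (∑ j ∈ S, (x j : ℤ))) * flow t m (S.erase l) x i) / (m + 1)

theorem flow_succ (t m : ℕ) (S : Finset ι) (x : ι → ℕ) (i : ι) :
    flow t (m + 1) S x i = (∑ l ∈ S, if i = l then share t m (x l) (∑ j ∈ S, (x j : ℤ)) else
      (1 - share t m (x l) (∑ j ∈ S, (x j : ℤ))) * flow t m (S.erase l) x i) / (m + 1) := rfl

theorem card_erase_of_card_succ {m : ℕ} {S : Finset ι} (hS : #S = m + 1) {l : ι} (hl : l ∈ S) :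
    #(S.erase l) = m := by rw [card_erase_of_mem hl, hS]; rfl

theorem sum_erase_int {S : Finset ι} {l : ι} (hl : l ∈ S) (x : ι → ℕ) :
    ∑ j ∈ S.erase l, (x j : ℤ) = ∑ j ∈ S, (x j : ℤ) - x l := by
  rw [← add_sum_erase S _ hl]; ring

/-- Either the remaining coordinates can still be increased, or all the flow goes to `l`. -/
theorem erase_lt_or_share_eq_one (ht : 1 ≤ t) {m : ℕ} {S : Finset ι} (hS : #S = m + 1)
    {x : ι → ℕ} (hx : ∀ l ∈ S, x l < t) {l : ι} (hl : l ∈ S) :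
    ∑ j ∈ S.erase l, (x j : ℤ) < m * ((t : ℤ) - 1) ∨
      share t m (x l) (∑ j ∈ S, (x j : ℤ)) = 1 := by
  have h := sum_le_card_mul (S := S.erase l) (x := x) fun j hj => hx j (mem_of_mem_erase hj)
  rw [card_erase_of_card_succ hS hl] at h
  rcases h.lt_or_eq with h | h
  · exact Or.inl h
  · exact Or.inr (share_eq_one_of_full ht (by rw [← h, sum_erase_int hl]))

theorem flow_nonneg (ht : 1 ≤ t) {m : ℕ} {S : Finset ι} (hS : #S = m) {x : ι → ℕ}
    (hx : ∀ l ∈ S, x l < t) (hk : ∑ j ∈ S, (x j : ℤ) < m * ((t : ℤ) - 1)) (i : ι) :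
    0 ≤ flow t m S x i := by
  induction m generalizing S with
  | zero => exact le_rfl
  | succ m ih =>
    have h1 := layerCount_sum_add_one_pos ht hk
    refine div_nonneg (sum_nonneg fun l hl => ?_) (by positivity)
    split_ifs with h
    · exact share_nonneg h1 (hx l hl)
    · rcases erase_lt_or_share_eq_one ht hS hx hl with h' | h'
      · exact mul_nonneg (sub_nonneg.2 (share_le_one h1 (hx l hl)))
          (ih (card_erase_of_card_succ hS hl) (fun j hj => hx j (mem_of_mem_erase hj)) h')
      · rw [h', sub_self, zero_mul]

theorem sum_flow (ht : 1 ≤ t) {m : ℕ} {S : Finset ι} (hS : #S = m) {x : ι → ℕ}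
    (hx : ∀ l ∈ S, x l < t) (hk : ∑ j ∈ S, (x j : ℤ) < m * ((t : ℤ) - 1)) :
    ∑ i ∈ S, flow t m S x i = 1 := by
  induction m generalizing S with
  | zero => rw [card_eq_zero] at hS; subst hS; simp at hk
  | succ m ih =>
    simp only [flow]
    rw [← sum_div, div_eq_one_iff_eq (by positivity), sum_comm]
    have : ∀ l ∈ S, (∑ i ∈ S, if i = l then share t m (x l) (∑ j ∈ S, (x j : ℤ)) else
        (1 - share t m (x l) (∑ j ∈ S, (x j : ℤ))) * flow t m (S.erase l) x i) = 1 := by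
      intro l hl
      rw [← add_sum_erase S _ hl, if_pos rfl,
        sum_congr rfl fun i hi => if_neg (ne_of_mem_erase hi), ← mul_sum]
      rcases erase_lt_or_share_eq_one ht hS hx hl with h' | h'
      · rw [ih (card_erase_of_card_succ hS hl) (fun j hj => hx j (mem_of_mem_erase hj)) h']
        ring
      · rw [h']; ring
    rw [sum_congr rfl this, sum_const, hS]
    simp

theorem flow_top (ht : 1 ≤ t) {m : ℕ} {S : Finset ι} (hS : #S = m) {x : ι → ℕ}
    (hx : ∀ l ∈ S, x l < t) (hk : ∑ j ∈ S, (x j : ℤ) < m * ((t : ℤ) - 1)) {i : ι}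
    (hi : x i = t - 1) : flow t m S x i = 0 := by
  induction m generalizing S with
  | zero => rfl
  | succ m ih =>
    have h1 := layerCount_sum_add_one_pos ht hk
    simp only [flow]
    rw [sum_eq_zero, zero_div]
    intro l hl
    split_ifs with h
    · rw [← h, hi]; exact share_top ht h1
    · rcases erase_lt_or_share_eq_one ht hS hx hl with h' | h'
      · rw [ih (card_erase_of_card_succ hS hl) (fun j hj => hx j (mem_of_mem_erase hj)) h',
          mul_zero]
      · rw [h', sub_self, zero_mul]

theorem sum_update_pred {S : Finset ι} {x : ι → ℕ} {i : ι} (hi : i ∈ S) (h : x i ≠ 0) :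
    ∑ j ∈ S, (Function.update x i (x i - 1) j : ℤ) = ∑ j ∈ S, (x j : ℤ) - 1 := by
  rw [← add_sum_erase S _ hi, ← add_sum_erase S (fun j => (x j : ℤ)) hi,
    sum_congr rfl fun j hj => by rw [Function.update_of_ne (ne_of_mem_erase hj)],
    Function.update_self]
  omega

theorem flow_inflow (ht : 1 ≤ t) {m : ℕ} {S : Finset ι} (hS : #S = m) {x : ι → ℕ}
    (hx : ∀ l ∈ S, x l < t) :
    (∑ i ∈ S, if x i = 0 then 0 else flow t m S (Function.update x i (x i - 1)) i) =
      layerCount t m (∑ j ∈ S, (x j : ℤ) - 1) / layerCount t m (∑ j ∈ S, (x j : ℤ)) := by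
  induction m generalizing S with
  | zero => rw [card_eq_zero] at hS; subst hS; simp [layerCount]
  | succ m ih =>
    have hpos := layerCount_sum_pos ht hx
    rw [hS] at hpos
    set k := ∑ j ∈ S, (x j : ℤ) with hk
    have hterm : ∀ i ∈ S,
        (if x i = 0 then 0 else flow t (m + 1) S (Function.update x i (x i - 1)) i) =
        (∑ l ∈ S, if i = l then (if x l = 0 then 0 else share t m (x l - 1) (k - 1)) else
          (1 - share t m (x l) (k - 1)) * (if x i = 0 then 0 else
            flow t m (S.erase l) (Function.update x i (x i - 1)) i)) / (m + 1) := by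
      intro i hi
      split_ifs with h
      · rw [sum_eq_zero, zero_div]
        intro l _
        split_ifs with h1 h2
        · rfl
        · exact absurd (h1 ▸ h) h2
        · rw [mul_zero]
      · simp only [flow]
        rw [sum_update_pred hi h]
        congr 1
        refine sum_congr rfl fun l hl => ?_
        split_ifs with h1 h2
        · exact absurd (h1 ▸ h2) h
        · rw [h1, Function.update_self]
        · rw [Function.update_of_ne (Ne.symm h1)]
    rw [sum_congr rfl hterm, ← sum_div, sum_comm, div_eq_iff (by positivity)]
    have : ∀ l ∈ S, (∑ i ∈ S, if i = l then
        (if x l = 0 then 0 else share t m (x l - 1) (k - 1)) else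
          (1 - share t m (x l) (k - 1)) * (if x i = 0 then 0 else
            flow t m (S.erase l) (Function.update x i (x i - 1)) i)) =
        layerCount t (m + 1) (k - 1) / layerCount t (m + 1) k := by
      intro l hl
      have hx' : ∀ j ∈ S.erase l, x j < t := fun j hj => hx j (mem_of_mem_erase hj)
      have hc := card_erase_of_card_succ hS hl
      have hb := layerCount_sum_pos ht hx'
      rw [hc, sum_erase_int hl, ← hk] at hb
      rw [← add_sum_erase S _ hl, if_pos rfl,
        sum_congr rfl fun i hi => if_neg (ne_of_mem_erase hi), ← mul_sum, ih hc hx',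
        sum_erase_int hl, ← hk]
      have := share_balance (k := k - 1) (hx l hl) (by simpa using hb) (by simpa using hpos)
      rw [sub_add_cancel] at this
      rw [← this, show k - (x l : ℤ) - 1 = k - 1 - x l by ring]
    rw [sum_congr rfl this, sum_const, hS, nsmul_eq_mul]
    push_cast
    ring

theorem share_le_quadratic (ht : 2 ≤ t) {m : ℕ} {k : ℤ} (hk0 : 0 ≤ k)
    (hk1 : k < (m + 1 : ℕ) * ((t : ℤ) - 1)) {v : ℕ} (hv : v < t) {a Y : ℝ}
    (ha : |a - (t - 1) / 2| ≤ t / 16) (hY : Y * t = k - (m + 1) * a) :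
    share t m v k ≤ shareConst / (m + 1) + 256 * Y ^ 2 / (m + 1) ^ 2 := by
  have htR : (2 : ℝ) ≤ t := by exact_mod_cast ht
  have hm : (0 : ℝ) < m + 1 := by positivity
  rcases le_or_gt |Y| ((m + 1) / 16) with h | h
  · refine (share_le_middle ht hk0 hk1 ?_ hv).trans (le_add_of_nonneg_right (by positivity))
    rw [abs_le] at *
    constructor <;> nlinarith
  · refine (share_le_one (layerCount_pos (by omega) (by omega) hk1) hv).trans ?_
    have h2 : ((m + 1) / 16 : ℝ) ^ 2 ≤ Y ^ 2 := by
      rw [← sq_abs Y]; exact pow_le_pow_left₀ (by positivity) h.le 2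
    have h3 : 1 ≤ 256 * Y ^ 2 / (m + 1) ^ 2 := by
      rw [le_div_iff₀ (by positivity)]; linarith
    have : 0 ≤ shareConst / (m + 1) := by unfold shareConst; positivity
    linarith

/-- The constant in the bound on the flow in a single direction. -/
noncomputable def flowConst : ℝ := shareConst + 3072

theorem sum_erase_sub_sq_le {m : ℕ} {S : Finset ι} (hS : #S = m + 1) {y : ι → ℝ}
    (hy : ∀ l ∈ S, |y l| ≤ 1) {i : ι} (hi : i ∈ S) :
    ∑ l ∈ S.erase i, (∑ j ∈ S, y j - y l) ^ 2 ≤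
      m * (∑ j ∈ S, y j) ^ 2 - 3 / 2 * (∑ j ∈ S, y j) ^ 2 + 2 + m := by
  set Y := ∑ j ∈ S, y j
  have hc := card_erase_of_card_succ hS hi
  have h1 : ∑ l ∈ S.erase i, (Y - y l) ^ 2 =
      m * Y ^ 2 - 2 * Y * ∑ l ∈ S.erase i, y l + ∑ l ∈ S.erase i, y l ^ 2 := by
    rw [mul_sum, ← hc, ← nsmul_eq_mul, ← sum_const, ← sum_sub_distrib, ← sum_add_distrib]
    exact sum_congr rfl fun l _ => by ring
  have h2 : ∑ l ∈ S.erase i, y l ^ 2 ≤ m := by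
    rw [← hc, ← nsmul_one]
    refine sum_le_card_nsmul _ _ _ fun l hl => ?_
    rw [sq_le_one_iff_abs_le_one]; exact hy l (mem_of_mem_erase hl)
  have h3 : ∑ l ∈ S.erase i, y l = Y - y i := by
    rw [eq_sub_iff_add_eq', add_sum_erase S y hi]
  rw [h1, h3]
  have h4 := hy i hi
  rw [abs_le] at h4
  nlinarith [sq_nonneg (Y - 2 * y i), sq_nonneg (y i)]

theorem flow_le_harmonic (ht : 2 ≤ t) {m : ℕ} {S : Finset ι} (hS : #S = m + 1) {x : ι → ℕ}
    (hx : ∀ l ∈ S, x l < t) (hk : ∑ j ∈ S, (x j : ℤ) < (m + 1 : ℕ) * ((t : ℤ) - 1)) {a : ℝ}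
    (ha : |a - (t - 1) / 2| ≤ t / 16) {i : ι} (hi : i ∈ S) :
    (m + 1) * flow t (m + 1) S x i ≤ flowConst * (∑ j ∈ range (m + 1), 1 / ((j : ℝ) + 1)) +
      512 * (∑ l ∈ S, ((x l : ℝ) - a) / t) ^ 2 / (m + 1) := by
  have htR : (2 : ℝ) ≤ t := by exact_mod_cast ht
  have ht0 : (0 : ℝ) < t := by positivity
  induction m generalizing S with
  | zero =>
    obtain ⟨l, rfl⟩ := card_eq_one.1 hS
    rw [mem_singleton] at hi
    subst hi
    have h1 := share_le_one (layerCount_sum_add_one_pos (by omega : 1 ≤ t) hk)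
      (hx i (mem_singleton_self i))
    have : 0 ≤ 512 * (∑ l ∈ {i}, ((x l : ℝ) - a) / t) ^ 2 / (((0 : ℕ) : ℝ) + 1) := by positivity
    have h2 : (1 : ℝ) ≤ flowConst := by unfold flowConst shareConst; norm_num
    simp [flow] at *
    linarith
  | succ m ih =>
    set y : ι → ℝ := fun l => ((x l : ℝ) - a) / t with hy
    set Y := ∑ l ∈ S, y l with hYdef
    set k := ∑ j ∈ S, (x j : ℤ) with hkdef
    set H := ∑ j ∈ range (m + 1), 1 / ((j : ℝ) + 1) with hH
    have hH0 : 0 ≤ H := sum_nonneg fun j _ => by positivity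
    have hF0 : 0 ≤ flowConst := by unfold flowConst shareConst; positivity
    have hYk : Y * t = k - ((m + 1 : ℕ) + 1) * a := by
      rw [hYdef, sum_mul, hkdef]
      push_cast
      rw [sum_congr rfl fun l _ => div_mul_cancel₀ ((x l : ℝ) - a) ht0.ne', sum_sub_distrib,
        sum_const, hS]
      simp
    have hyb : ∀ l ∈ S, |y l| ≤ 1 := by
      intro l hl
      have h0 : ((x l : ℕ) : ℝ) + 1 ≤ t := by exact_mod_cast hx l hl
      have h1 : (0 : ℝ) ≤ x l := by positivity
      rw [hy, abs_div, abs_of_pos ht0, div_le_one ht0]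
      rw [abs_le] at *
      constructor <;> linarith
    have hshare := share_le_quadratic ht (by positivity) hk (hx i hi) ha hYk
    have h1 := layerCount_sum_add_one_pos (by omega : 1 ≤ t) hk
    have hrest : ∀ l ∈ S.erase i, (if i = l then share t (m + 1) (x l) k else
        (1 - share t (m + 1) (x l) k) * flow t (m + 1) (S.erase l) x i) ≤
        (flowConst * H + 512 * (Y - y l) ^ 2 / (m + 1)) / (m + 1) := by
      intro l hl
      have hl' := mem_of_mem_erase hl
      have hil : i ≠ l := (ne_of_mem_erase hl).symm
      rw [if_neg hil]
      have hx' : ∀ j ∈ S.erase l, x j < t := fun j hj => hx j (mem_of_mem_erase hj)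
      have hc := card_erase_of_card_succ hS hl'
      rcases erase_lt_or_share_eq_one (by omega : 1 ≤ t) hS hx hl' with h' | h'
      · have hf0 := flow_nonneg (by omega : 1 ≤ t) hc hx' h' i
        have hf := ih hc hx' h' (mem_erase.2 ⟨hil, hi⟩)
        have hYl : ∑ j ∈ S.erase l, y j = Y - y l := by
          rw [eq_sub_iff_add_eq', add_sum_erase S y hl']
        rw [hYl] at hf
        have hs := share_nonneg h1 (hx l hl')
        rw [le_div_iff₀ (by positivity)]
        refine le_trans ?_ hf
        rw [mul_comm ((m : ℝ) + 1)]
        exact mul_le_mul_of_nonneg_right (mul_le_of_le_one_left hf0 (sub_le_self 1 hs))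
          (by positivity)
      · rw [h', sub_self, zero_mul]; positivity
    have hsum : ((m + 1 : ℕ) + 1) * flow t (m + 1 + 1) S x i ≤ share t (m + 1) (x i) k +
        (flowConst * H + 512 / (m + 1) ^ 2 *
          ((m + 1 : ℕ) * Y ^ 2 - 3 / 2 * Y ^ 2 + 2 + (m + 1 : ℕ))) := by
      have e : ((m + 1 : ℕ) + 1) * flow t (m + 1 + 1) S x i =
          ∑ l ∈ S, if i = l then share t (m + 1) (x l) k else
            (1 - share t (m + 1) (x l) k) * flow t (m + 1) (S.erase l) x i := by
        rw [flow_succ, mul_div_cancel₀]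
        positivity
      rw [e, ← add_sum_erase S _ hi, if_pos rfl]
      refine add_le_add le_rfl ((sum_le_sum hrest).trans ?_)
      have := sum_erase_sub_sq_le hS hyb hi
      rw [← sum_div, sum_add_distrib, sum_const, card_erase_of_card_succ hS hi, ← sum_div,
        ← mul_sum, nsmul_eq_mul, add_div]
      refine add_le_add ?_ ?_
      · push_cast; rw [mul_div_cancel_left₀]; positivity
      · rw [div_div, ← sq, div_mul_eq_mul_div]
        gcongr
    refine hsum.trans ?_
    rw [sum_range_succ, ← hH, mul_add flowConst]
    push_cast at hshare ⊢
    have hm : (1 : ℝ) ≤ m + 1 := by linarith [m.cast_nonneg (α := ℝ)]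
    generalize (m : ℝ) + 1 = r at *
    have hr : 0 < r := by linarith
    have hQ : 256 * Y ^ 2 / (r + 1) ^ 2 + 512 / r ^ 2 * (r * Y ^ 2 - 3 / 2 * Y ^ 2) ≤
        512 * Y ^ 2 / (r + 1) := by
      have : 512 * Y ^ 2 / (r + 1) - (256 * Y ^ 2 / (r + 1) ^ 2 +
          512 / r ^ 2 * (r * Y ^ 2 - 3 / 2 * Y ^ 2)) =
          Y ^ 2 * (1024 * r + 768) / (r ^ 2 * (r + 1) ^ 2) := by
        field_simp
        ring
      have h0 : 0 ≤ Y ^ 2 * (1024 * r + 768) / (r ^ 2 * (r + 1) ^ 2) := by positivity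
      linarith
    have hC : 512 / r ^ 2 * (2 + r) ≤ 3072 / (r + 1) := by
      rw [div_mul_eq_mul_div, div_le_div_iff₀ (by positivity) (by positivity)]
      nlinarith
    have hF : flowConst * (1 / (r + 1)) = shareConst / (r + 1) + 3072 / (r + 1) := by
      unfold flowConst; ring
    rw [hF]
    linarith

theorem flow_univ_le (ht : 2 ≤ t) {n : ℕ} (hn : 1 ≤ n) {x : Fin n → ℕ} (hx : ∀ l, x l < t)
    (hk : ∑ j, (x j : ℤ) < n * ((t : ℤ) - 1))
    (ha : |((∑ j, (x j : ℤ) : ℤ) : ℝ) - n * (t - 1) / 2| ≤ n * t / 16) (i : Fin n) :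
    flow t n univ x i ≤ flowConst * (1 + Real.log n) / n := by
  obtain ⟨m, rfl⟩ : ∃ m, n = m + 1 := ⟨n - 1, by omega⟩
  have hm : (0 : ℝ) < (m + 1 : ℕ) := by positivity
  set a : ℝ := ((∑ j, (x j : ℤ) : ℤ) : ℝ) / (m + 1 : ℕ) with hadef
  have ha' : |a - (t - 1) / 2| ≤ t / 16 := by
    have : a - (t - 1) / 2 =
        (((∑ j, (x j : ℤ) : ℤ) : ℝ) - (m + 1 : ℕ) * (t - 1) / 2) / (m + 1 : ℕ) := by
      rw [hadef]; field_simp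
    rw [this, abs_div, abs_of_pos hm, div_le_iff₀ hm]
    linarith
  have h := flow_le_harmonic ht (card_fin (m + 1)) (fun l _ => hx l) hk ha' (mem_univ i)
  have hY : ∑ l, ((x l : ℝ) - a) / t = 0 := by
    rw [← sum_div, sum_sub_distrib, sum_const, card_fin, nsmul_eq_mul, hadef,
      mul_div_cancel₀ _ hm.ne']
    push_cast
    simp
  have hH : (∑ j ∈ range (m + 1), 1 / ((j : ℝ) + 1)) ≤ 1 + Real.log (m + 1 : ℕ) := by
    have := harmonic_le_one_add_log (m + 1)
    unfold harmonic at this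
    push_cast at this ⊢
    simpa only [one_div] using this
  rw [hY] at h
  have hF0 : 0 ≤ flowConst := by unfold flowConst shareConst; positivity
  rw [le_div_iff₀ hm, mul_comm]
  push_cast at h hH ⊢
  refine h.trans ?_
  rw [zero_pow two_ne_zero, mul_zero, zero_div, add_zero]
  exact mul_le_mul_of_nonneg_left hH hF0

end Flow

section RandomChain

variable {X : Type} [Fintype X] [DecidableEq X] [PartialOrder X]

/-- A Markov kernel on a ranked finite poset whose steps go one rank up and which carries the
uniform distribution of each rank `k < R`, of size `a k`, to that of the next rank. -/
structure UniformKernel (r : X → ℕ) (a : ℕ → ℝ) (R : ℕ) (T : X → X → ℝ) : Prop where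
  nonneg : ∀ z y, r z < R → 0 ≤ T z y
  sum_eq_one : ∀ z, r z < R → ∑ y, T z y = 1
  inflow : ∀ y, r y ≠ 0 → r y ≤ R → ∑ z, T z y = a (r y - 1) / a (r y)
  step : ∀ z y, T z y ≠ 0 → z < y ∧ r y = r z + 1
  pos : ∀ k, k ≤ R → 0 < a k
  zero : a 0 = 1
  existsUnique_bot : ∃! x, r x = 0

/-- A finitely supported random chain from rank `0` to rank `K` in a ranked poset, uniform in
each rank, in which an element of a rank satisfying `G` has probability at most `δ` given the
past. -/
structure RandomChain (r : X → ℕ) (a : ℕ → ℝ) (G : ℕ → Prop) (δ : ℝ) (K : ℕ) where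
  Ω : Type
  [fin : Fintype Ω]
  w : Ω → ℝ
  last : Ω → X
  C : Ω → Finset X
  nonneg : ∀ ω, 0 ≤ w ω
  sum_eq_one : ∑ ω, w ω = 1
  rank_last : ∀ ω, w ω ≠ 0 → r (last ω) = K
  le_last : ∀ ω, w ω ≠ 0 → ∀ x ∈ C ω, x ≤ last ω ∧ r x ≤ K
  chain : ∀ ω, w ω ≠ 0 → ∀ x ∈ C ω, ∀ y ∈ C ω, x = y ∨ (x < y ∧ r x < r y) ∨ (y < x ∧ r y < r x)
  prob_last : ∀ x, r x = K → (∑ ω, if last ω = x then w ω else 0) = 1 / a K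
  prob_mem : ∀ x, r x ≤ K → (∑ ω, if x ∈ C ω then w ω else 0) = 1 / a (r x)
  prob_pair : ∀ x y, r x < r y → r y ≤ K → G (r y) →
    (∑ ω, if x ∈ C ω ∧ y ∈ C ω then w ω else 0) ≤ δ / a (r x)

attribute [instance] RandomChain.fin

variable {r : X → ℕ} {a : ℕ → ℝ} {R : ℕ} {T : X → X → ℝ} {G : ℕ → Prop} {δ : ℝ}

theorem UniformKernel.nonempty_randomChain_zero (h : UniformKernel r a R T) :
    Nonempty (RandomChain r a G δ 0) := by
  obtain ⟨b, hb, hb'⟩ := h.existsUnique_bot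
  exact ⟨{
    Ω := Unit
    w := fun _ => 1
    last := fun _ => b
    C := fun _ => {b}
    nonneg := fun _ => zero_le_one
    sum_eq_one := by simp
    rank_last := fun _ _ => hb
    le_last := fun _ _ x hx => by rw [mem_singleton.1 hx]; exact ⟨le_rfl, hb.le⟩
    chain := fun _ _ x hx y hy => Or.inl ((mem_singleton.1 hx).trans (mem_singleton.1 hy).symm)
    prob_last := fun x hx => by simp [hb' x hx, h.zero]
    prob_mem := fun x hx => by
      have hx := Nat.le_zero.1 hx
      rw [hx, hb' x hx]; simp [h.zero]
    prob_pair := fun x y hxy hy => by omega }⟩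

theorem RandomChain.nonempty_succ (h : UniformKernel r a R T) (hδ : ∀ z y, G (r y) → T z y ≤ δ)
    {K : ℕ} (hK : K < R) (c : RandomChain r a G δ K) : Nonempty (RandomChain r a G δ (K + 1)) := by
  have hne : ∀ p : c.Ω × X, c.w p.1 * T (c.last p.1) p.2 ≠ 0 →
      c.w p.1 ≠ 0 ∧ c.last p.1 < p.2 ∧ r p.2 = K + 1 := by
    intro p hp
    have hw := left_ne_zero_of_mul hp
    obtain ⟨h1, h2⟩ := h.step _ _ (right_ne_zero_of_mul hp)
    exact ⟨hw, h1, by rw [h2, c.rank_last _ hw]⟩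
  -- events depending only on the past keep their probability
  have hpast : ∀ (P : c.Ω → Prop) [DecidablePred P],
      (∑ p : c.Ω × X, if P p.1 then c.w p.1 * T (c.last p.1) p.2 else 0) =
        ∑ ω, if P ω then c.w ω else 0 := by
    intro P _
    rw [Fintype.sum_prod_type]
    refine sum_congr rfl fun ω _ => ?_
    split_ifs
    · simp only
      by_cases hw : c.w ω = 0
      · simp [hw]
      · rw [← mul_sum, h.sum_eq_one _ (by rw [c.rank_last _ hw]; exact hK), mul_one]
    · simp
  have hlast : ∀ y, r y = K + 1 →
      (∑ p : c.Ω × X, if p.2 = y then c.w p.1 * T (c.last p.1) p.2 else 0) = 1 / a (K + 1) := by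
    intro y hy
    rw [Fintype.sum_prod_type]
    simp only [sum_ite_eq', mem_univ, if_true]
    have hin := h.inflow y (by omega) (by omega)
    rw [hy, Nat.add_sub_cancel] at hin
    have e : ∀ ω, c.w ω * T (c.last ω) y =
        ∑ z, (if c.last ω = z then c.w ω else 0) * T z y := by
      intro ω; simp
    rw [sum_congr rfl fun ω _ => e ω, sum_comm]
    have e2 : ∀ z, ∑ ω, (if c.last ω = z then c.w ω else 0) * T z y = 1 / a K * T z y := by
      intro z
      rw [← sum_mul]
      by_cases hz : T z y = 0
      · simp [hz]
      · rw [c.prob_last z (by have := (h.step _ _ hz).2; omega)]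
    rw [sum_congr rfl fun z _ => e2 z, ← mul_sum, hin]
    have := h.pos K hK.le
    have := h.pos (K + 1) hK
    field_simp
  have hmem_old : ∀ x, r x ≤ K → ∀ p : c.Ω × X, c.w p.1 * T (c.last p.1) p.2 ≠ 0 →
      (x ∈ insert p.2 (c.C p.1) ↔ x ∈ c.C p.1) := by
    intro x hx p hp
    have := (hne p hp).2.2
    rw [mem_insert, or_iff_right]
    rintro rfl
    omega
  have hmem_new : ∀ x, r x = K + 1 → ∀ p : c.Ω × X, c.w p.1 * T (c.last p.1) p.2 ≠ 0 →
      (x ∈ insert p.2 (c.C p.1) ↔ p.2 = x) := by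
    intro x hx p hp
    rw [mem_insert, or_iff_left, eq_comm]
    intro hx'
    have := (c.le_last _ (hne p hp).1 x hx').2
    omega
  have hcongr : ∀ (P Q : c.Ω × X → Prop) [DecidablePred P] [DecidablePred Q],
      (∀ p, c.w p.1 * T (c.last p.1) p.2 ≠ 0 → (P p ↔ Q p)) →
      (∑ p, if P p then c.w p.1 * T (c.last p.1) p.2 else 0) =
        ∑ p, if Q p then c.w p.1 * T (c.last p.1) p.2 else 0 := by
    intro P Q _ _ hPQ
    refine sum_congr rfl fun p _ => ?_
    by_cases hp : c.w p.1 * T (c.last p.1) p.2 = 0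
    · simp [hp]
    · simp only [hPQ p hp]
  exact ⟨{
    Ω := c.Ω × X
    w := fun p => c.w p.1 * T (c.last p.1) p.2
    last := fun p => p.2
    C := fun p => insert p.2 (c.C p.1)
    nonneg := fun p => by
      by_cases hw : c.w p.1 = 0
      · simp [hw]
      · exact mul_nonneg (c.nonneg _) (h.nonneg _ _ (by rw [c.rank_last _ hw]; exact hK))
    sum_eq_one := by
      have := hpast (fun _ => True)
      simpa [c.sum_eq_one] using this
    rank_last := fun p hp => (hne p hp).2.2
    le_last := fun p hp x hx => by
      obtain ⟨hw, hl, hr⟩ := hne p hp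
      rcases mem_insert.1 hx with rfl | hx
      · exact ⟨le_rfl, hr.le⟩
      · obtain ⟨h1, h2⟩ := c.le_last _ hw x hx
        exact ⟨h1.trans hl.le, by omega⟩
    chain := fun p hp x hx y hy => by
      obtain ⟨hw, hl, hr⟩ := hne p hp
      have key : ∀ z ∈ c.C p.1, z < p.2 ∧ r z < r p.2 := fun z hz => by
        obtain ⟨h1, h2⟩ := c.le_last _ hw z hz
        exact ⟨h1.trans_lt hl, by omega⟩
      rcases mem_insert.1 hx with rfl | hx <;> rcases mem_insert.1 hy with rfl | hy
      · exact Or.inl rfl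
      · exact Or.inr (Or.inr (key y hy))
      · exact Or.inr (Or.inl (key x hx))
      · exact c.chain _ hw x hx y hy
    prob_last := hlast
    prob_mem := fun x hx => by
      rcases Nat.lt_succ_iff_lt_or_eq.1 (Nat.lt_succ_of_le hx) with hx | hx
      · rw [hcongr _ _ (hmem_old x (by omega)), hpast fun ω => x ∈ c.C ω]
        exact c.prob_mem x (by omega)
      · rw [hcongr _ _ (hmem_new x hx), hx]
        exact hlast x hx
    prob_pair := fun x y hxy hy hG => by
      rcases Nat.lt_succ_iff_lt_or_eq.1 (Nat.lt_succ_of_le hy) with hy | hy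
      · rw [hcongr _ (fun p => x ∈ c.C p.1 ∧ y ∈ c.C p.1) fun p hp =>
          and_congr (hmem_old x (by omega) p hp) (hmem_old y (by omega) p hp),
          hpast fun ω => x ∈ c.C ω ∧ y ∈ c.C ω]
        exact c.prob_pair x y hxy (by omega) hG
      · rw [hcongr _ (fun p => x ∈ c.C p.1 ∧ p.2 = y) fun p hp =>
          and_congr (hmem_old x (by omega) p hp) (hmem_new y hy p hp), Fintype.sum_prod_type,
          ← mul_one_div, ← c.prob_mem x (by omega), mul_sum]
        refine sum_le_sum fun ω _ => ?_
        by_cases hx : x ∈ c.C ω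
        · simp only [hx, true_and, sum_ite_eq', mem_univ, if_true]
          rw [mul_comm]
          exact mul_le_mul_of_nonneg_right (hδ _ _ hG) (c.nonneg _)
        · simp [hx] }⟩

theorem UniformKernel.nonempty_randomChain (h : UniformKernel r a R T)
    (hδ : ∀ z y, G (r y) → T z y ≤ δ) {K : ℕ} (hK : K ≤ R) :
    Nonempty (RandomChain r a G δ K) := by
  induction K with
  | zero => exact h.nonempty_randomChain_zero
  | succ K ih => exact (ih (by omega)).elim (RandomChain.nonempty_succ h hδ hK)

/-- Supersaturation: a set of elements larger than the largest rank contains an element with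
many elements of the set above it. -/
theorem UniformKernel.exists_many_above [DecidableLT X] (h : UniformKernel r a R T)
    (hδ0 : 0 < δ) (hδ : ∀ z y, G (r y) → T z y ≤ δ) {N : ℝ} {F : Finset X} (hF : F.Nonempty)
    (hFR : ∀ x ∈ F, r x ≤ R) (hFG : ∀ x ∈ F, G (r x)) (hN : ∀ x ∈ F, a (r x) ≤ N) :
    ∃ x ∈ F, (#F / N - 1) / (2 * δ) ≤ #{y ∈ F | x < y} := by
  obtain ⟨c⟩ := h.nonempty_randomChain hδ le_rfl
  by_contra! hcon
  set D := (#F / N - 1) / (2 * δ) with hD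
  have ha : ∀ x ∈ F, 0 < 1 / a (r x) := fun x hx => one_div_pos.2 (h.pos _ (hFR x hx))
  set M := ∑ x ∈ F, 1 / a (r x) with hM
  have hM0 : 0 < M := sum_pos ha hF
  have hMN : #F / N ≤ M := by
    rw [hM, div_eq_mul_one_div, ← nsmul_eq_mul]
    exact card_nsmul_le_sum _ _ _ fun x hx =>
      one_div_le_one_div_of_le (h.pos _ (hFR x hx)) (hN x hx)
  -- the number of elements of `F` on the chain
  set f : c.Ω → ℝ := fun ω => ∑ x ∈ F, if x ∈ c.C ω then 1 else 0 with hf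
  have h1 : ∑ ω, c.w ω * f ω = M := by
    simp only [hf, mul_sum]
    rw [sum_comm]
    refine sum_congr rfl fun x hx => ?_
    rw [← c.prob_mem x (hFR x hx)]
    simp
  have hsq : M ^ 2 ≤ ∑ ω, c.w ω * f ω ^ 2 := by
    have : 0 ≤ ∑ ω, c.w ω * (f ω - M) ^ 2 :=
      sum_nonneg fun ω _ => mul_nonneg (c.nonneg ω) (sq_nonneg _)
    have e : ∑ ω, c.w ω * (f ω - M) ^ 2 =
        ∑ ω, c.w ω * f ω ^ 2 - 2 * M * ∑ ω, c.w ω * f ω + M ^ 2 * ∑ ω, c.w ω := by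
      rw [mul_sum univ _ (2 * M), mul_sum univ _ (M ^ 2), ← sum_sub_distrib, ← sum_add_distrib]
      exact sum_congr rfl fun ω _ => by ring
    rw [e, h1, c.sum_eq_one] at this
    nlinarith
  have hpt : ∀ ω, c.w ω * f ω ^ 2 ≤ c.w ω * f ω +
      2 * ∑ x ∈ F, ∑ y ∈ F with x < y,
        if r x < r y then (if x ∈ c.C ω ∧ y ∈ c.C ω then c.w ω else 0) else 0 := by
    intro ω
    by_cases hw : c.w ω = 0
    · simp [hw]
    · have hw0 := c.nonneg ω
      have e1 : c.w ω * f ω ^ 2 =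
          ∑ x ∈ F, ∑ y ∈ F, if x ∈ c.C ω ∧ y ∈ c.C ω then c.w ω else 0 := by
        rw [sq, hf, sum_mul_sum, mul_sum]
        refine sum_congr rfl fun x _ => ?_
        rw [mul_sum]
        refine sum_congr rfl fun y _ => ?_
        by_cases hx : x ∈ c.C ω <;> by_cases hy : y ∈ c.C ω <;> simp [hx, hy]
      have e2 : c.w ω * f ω = ∑ x ∈ F, ∑ y ∈ F, if x = y then
          (if x ∈ c.C ω then c.w ω else 0) else 0 := by
        rw [hf, mul_sum]
        refine sum_congr rfl fun x hx => ?_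
        rw [sum_ite_eq, if_pos hx]
        simp
      set g : X → X → ℝ := fun x y => if x < y then
        (if r x < r y then (if x ∈ c.C ω ∧ y ∈ c.C ω then c.w ω else 0) else 0) else 0 with hg
      have hg0 : ∀ x y, 0 ≤ g x y := fun x y => by
        simp only [hg]; split_ifs <;> first | exact hw0 | exact le_rfl
      have e3 : (∑ x ∈ F, ∑ y ∈ F with x < y,
          if r x < r y then (if x ∈ c.C ω ∧ y ∈ c.C ω then c.w ω else 0) else 0) =
          ∑ x ∈ F, ∑ y ∈ F, g x y := sum_congr rfl fun x _ => sum_filter _ _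
      have e4 : ∑ x ∈ F, ∑ y ∈ F, g x y = ∑ x ∈ F, ∑ y ∈ F, g y x := sum_comm
      rw [e3, two_mul, e1, e2]
      nth_rw 2 [e4]
      rw [← sum_add_distrib, ← sum_add_distrib]
      refine sum_le_sum fun x _ => ?_
      rw [← sum_add_distrib, ← sum_add_distrib]
      refine sum_le_sum fun y _ => ?_
      have g1 := hg0 x y
      have g2 := hg0 y x
      by_cases hxy : x ∈ c.C ω ∧ y ∈ c.C ω
      · rw [if_pos hxy]
        rcases c.chain ω hw x hxy.1 y hxy.2 with rfl | ⟨hlt, hr⟩ | ⟨hlt, hr⟩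
        · rw [if_pos rfl, if_pos hxy.1]; linarith
        · have : g x y = c.w ω := by simp only [hg]; rw [if_pos hlt, if_pos hr, if_pos hxy]
          have : 0 ≤ (if x = y then (if x ∈ c.C ω then c.w ω else 0) else 0 : ℝ) := by
            split_ifs <;> first | exact hw0 | exact le_rfl
          linarith
        · have : g y x = c.w ω := by simp only [hg]; rw [if_pos hlt, if_pos hr, if_pos hxy.symm]
          have : 0 ≤ (if x = y then (if x ∈ c.C ω then c.w ω else 0) else 0 : ℝ) := by
            split_ifs <;> first | exact hw0 | exact le_rfl
          linarith
      · rw [if_neg hxy]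
        have : 0 ≤ (if x = y then (if x ∈ c.C ω then c.w ω else 0) else 0 : ℝ) := by
          split_ifs <;> first | exact hw0 | exact le_rfl
        linarith
  have hup : M ^ 2 ≤ M + 2 * ∑ x ∈ F, ∑ y ∈ F with x < y, δ / a (r x) := by
    refine hsq.trans ((sum_le_sum fun ω _ => hpt ω).trans ?_)
    rw [sum_add_distrib, h1, ← mul_sum]
    refine add_le_add le_rfl (mul_le_mul_of_nonneg_left ?_ zero_le_two)
    rw [sum_comm]
    refine sum_le_sum fun x hx => ?_
    rw [sum_comm]
    refine sum_le_sum fun y hy => ?_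
    by_cases hr : r x < r y
    · simp only [if_pos hr]
      have hy := mem_of_mem_filter y hy
      exact c.prob_pair x y hr (hFR y hy) (hFG y hy)
    · simp only [if_neg hr, sum_const_zero]
      exact (div_pos hδ0 (h.pos _ (hFR x hx))).le
  have hlt : ∑ x ∈ F, ∑ y ∈ F with x < y, δ / a (r x) < D * δ * M := by
    rw [hM, mul_sum]
    refine sum_lt_sum_of_nonempty hF fun x hx => ?_
    rw [sum_const, nsmul_eq_mul, mul_assoc, mul_one_div]
    exact mul_lt_mul_of_pos_right (hcon x hx) (div_pos hδ0 (h.pos _ (hFR x hx)))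
  have hDδ : 2 * (D * δ) = #F / N - 1 := by rw [hD]; field_simp
  nlinarith

end RandomChain

section GridKernel

variable {t n : ℕ}

/-- The rank of a point of `[t]^n`. -/
def gridRank (x : Fin n → Fin t) : ℕ := ∑ i, (x i : ℕ)

/-- The Markov kernel on `[t]^n` moving along `flow`. -/
noncomputable def gridKernel (z y : Fin n → Fin t) : ℝ :=
  ∑ i, if (fun j => (y j : ℕ)) = Function.update (fun j => (z j : ℕ)) i (z i + 1) then
    flow t n univ (fun j => (z j : ℕ)) i else 0

theorem cast_gridRank (x : Fin n → Fin t) : ((gridRank x : ℕ) : ℤ) = ∑ i, ((x i : ℕ) : ℤ) := by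
  unfold gridRank; push_cast; rfl

theorem gridRank_le (x : Fin n → Fin t) : gridRank x ≤ n * (t - 1) := by
  have := sum_le_card_nsmul univ (fun i => (x i : ℕ)) (t - 1) fun i _ => by
    have := (x i).2; omega
  simpa [gridRank] using this

theorem lt_of_eq_update {z y : Fin n → Fin t} {i : Fin n}
    (h : (fun j => (y j : ℕ)) = Function.update (fun j => (z j : ℕ)) i (z i + 1)) :
    z < y ∧ gridRank y = gridRank z + 1 := by
  have hi : (y i : ℕ) = z i + 1 := by simpa using congrFun h i
  have hne : ∀ j, j ≠ i → (y j : ℕ) = z j := fun j hj => by simpa [hj] using congrFun h j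
  constructor
  · refine Pi.lt_def.2 ⟨fun j => ?_, i, ?_⟩
    · by_cases hj : j = i
      · subst hj; rw [Fin.le_def]; omega
      · rw [Fin.le_def, hne j hj]
    · rw [Fin.lt_def]; omega
  · unfold gridRank
    rw [← add_sum_erase _ _ (mem_univ i), ← add_sum_erase _ (fun j => (z j : ℕ)) (mem_univ i),
      sum_congr rfl fun j hj => hne j (ne_of_mem_erase hj), hi]
    ring

theorem cast_gridRank_lt (ht : 1 ≤ t) {z : Fin n → Fin t} (hz : gridRank z < n * (t - 1)) :
    ∑ j, ((z j : ℕ) : ℤ) < n * ((t : ℤ) - 1) := by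
  rw [← cast_gridRank]
  have : ((t - 1 : ℕ) : ℤ) = t - 1 := by omega
  rw [← this]; exact_mod_cast hz

theorem gridKernel_uniform (ht : 1 ≤ t) :
    UniformKernel (gridRank (t := t) (n := n)) (fun k => layerCount t n k) (n * (t - 1))
      gridKernel where
  nonneg z y hz := sum_nonneg fun i _ => by
    split_ifs
    · exact flow_nonneg ht (card_fin n) (fun l _ => (z l).2) (cast_gridRank_lt ht hz) i
    · exact le_rfl
  sum_eq_one z hz := by
    have hk := cast_gridRank_lt ht hz
    rw [← sum_flow ht (card_fin n) (fun l _ => (z l).2) hk]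
    unfold gridKernel
    rw [sum_comm]
    refine sum_congr rfl fun i _ => ?_
    by_cases hi : (z i : ℕ) = t - 1
    · rw [flow_top ht (card_fin n) (fun l _ => (z l).2) hk hi]; simp
    · have hlt : (z i : ℕ) + 1 < t := by have := (z i).2; omega
      have e : ∀ y : Fin n → Fin t,
          (fun j => (y j : ℕ)) = Function.update (fun j => (z j : ℕ)) i (z i + 1) ↔
            y = Function.update z i ⟨z i + 1, hlt⟩ := by
        intro y
        simp only [funext_iff, Function.update_apply, Fin.ext_iff]
        refine forall_congr' fun j => ?_
        split_ifs <;> rfl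
      simp only [e, sum_ite_eq', mem_univ, if_true]
  inflow y _ _ := by
    have hin := flow_inflow ht (card_fin n) (x := fun j => (y j : ℕ)) fun l _ => (y l).2
    rw [← cast_gridRank] at hin
    rw [Nat.cast_sub (by omega), Nat.cast_one, ← hin]
    unfold gridKernel
    rw [sum_comm]
    refine sum_congr rfl fun i _ => ?_
    split_ifs with hi
    · refine sum_eq_zero fun z _ => if_neg fun h => ?_
      have := congrFun h i
      simp at this
      omega
    · have hlt : (y i : ℕ) - 1 < t := by have := (y i).2; omega
      have e : ∀ z : Fin n → Fin t,
          (fun j => (y j : ℕ)) = Function.update (fun j => (z j : ℕ)) i (z i + 1) ↔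
            z = Function.update y i ⟨y i - 1, hlt⟩ := by
        intro z
        simp only [funext_iff, Function.update_apply, Fin.ext_iff]
        refine forall_congr' fun j => ?_
        split_ifs with hj
        · obtain rfl := Fin.ext hj; simp only; omega
        · exact eq_comm
      simp only [e, sum_ite_eq', mem_univ, if_true]
      congr 1
      ext j
      simp only [Function.update_apply]
      split_ifs <;> rfl
  step z y h := by
    obtain ⟨i, -, hi⟩ := exists_ne_zero_of_sum_ne_zero h
    exact lt_of_eq_update (not_not.1 fun h => hi (if_neg h))
  pos k hk := layerCount_pos ht (by positivity) (by
    have : ((t - 1 : ℕ) : ℤ) = t - 1 := by omega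
    rw [← this]; exact_mod_cast hk)
  zero := by
    induction n with
    | zero => simp [layerCount]
    | succ n ih =>
      rw [layerCount_succ, ← ih, sum_eq_single 0]
      · simp
      · intro i _ hi
        exact layerCount_of_neg _ _ (by omega)
      · simp; omega
  existsUnique_bot := by
    refine ⟨fun _ => ⟨0, ht⟩, by simp [gridRank], fun x hx => ?_⟩
    ext i
    exact (sum_eq_zero_iff.1 hx) i (mem_univ i)

/-- The ranks of `[t]^n` near the middle. -/
def MiddleRank (t n k : ℕ) : Prop := |(k : ℝ) - n * (t - 1) / 2| ≤ n * t / 32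

theorem gridKernel_le (ht : 2 ≤ t) (hn : 16 ≤ n) (z y : Fin n → Fin t)
    (hy : MiddleRank t n (gridRank y)) :
    gridKernel z y ≤ flowConst * (1 + Real.log n) / n := by
  have hF0 : 0 ≤ flowConst := by unfold flowConst shareConst; positivity
  have hδ : 0 ≤ flowConst * (1 + Real.log n) / n := by positivity
  by_cases h : ∃ i, (fun j => (y j : ℕ)) = Function.update (fun j => (z j : ℕ)) i (z i + 1)
  · obtain ⟨i, hi⟩ := h
    have hr := (lt_of_eq_update hi).2
    unfold gridKernel
    rw [sum_eq_single i _ (by simp), if_pos hi]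
    · have hk := cast_gridRank_lt (by omega : 1 ≤ t) (z := z) (by have := gridRank_le y; omega)
      refine flow_univ_le ht (by omega) (fun l => (z l).2) hk ?_ i
      rw [← cast_gridRank]
      unfold MiddleRank at hy
      rw [hr] at hy
      push_cast at hy ⊢
      have hnt : (32 : ℝ) ≤ n * t := by exact_mod_cast Nat.mul_le_mul hn ht
      rw [abs_le] at *
      constructor <;> linarith
    · intro l _ hl
      refine if_neg fun h => ?_
      have h1 := congrFun h i
      have h2 := congrFun hi i
      simp [Ne.symm hl] at h1 h2
      omega
  · push Not at h
    unfold gridKernel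
    rw [sum_eq_zero fun i _ => if_neg (h i)]
    exact hδ

/-- The number of elements of `[t]^n` of rank `k` is `layerCount t n k`. -/
theorem card_gridRank_eq (t n : ℕ) (k : ℤ) :
    (#{x : Fin n → Fin t | (gridRank x : ℤ) = k} : ℝ) = layerCount t n k := by
  induction n generalizing k with
  | zero =>
    simp only [layerCount, gridRank, univ_eq_empty, sum_empty, Nat.cast_zero]
    by_cases hk : k = 0
    · simp [hk]
    · simp [hk, eq_comm]
  | succ n ih =>
    rw [layerCount_succ, ← Fin.sum_univ_eq_sum_range (fun i => layerCount t n (k - i))]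
    simp only [← ih]
    rw [card_filter, ← (Fin.consEquiv fun _ : Fin (n + 1) => Fin t).sum_comp,
      Fintype.sum_prod_type]
    push_cast
    refine sum_congr rfl fun v _ => ?_
    rw [card_filter]
    push_cast
    refine sum_congr rfl fun x _ => ?_
    have : (gridRank ((Fin.consEquiv fun _ : Fin (n + 1) => Fin t) (v, x)) : ℤ) =
        v + gridRank x := by
      simp [gridRank, Fin.sum_univ_succ, Fin.consEquiv]
    simp only [this, eq_sub_iff_add_eq']

end GridKernel

section AntichainCount

open scoped Classical in
/-- The number of antichains contained in `F`. -/
noncomputable def antichainCount {X : Type*} [PartialOrder X] (F : Finset X) : ℕ :=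
  #(F.powerset.filter fun A : Finset X => IsAntichain (· ≤ ·) (A : Set X))

variable {X : Type*} [PartialOrder X]

theorem antichainCount_empty : antichainCount (∅ : Finset X) = 1 := by
  classical
  simp [antichainCount, filter_singleton]

theorem antichainCount_mono {F G : Finset X} (h : F ⊆ G) :
    antichainCount F ≤ antichainCount G := by
  classical
  exact card_le_card (filter_subset_filter _ (powerset_mono.2 h))

theorem antichainCount_pos (F : Finset X) : 0 < antichainCount F :=
  lt_of_lt_of_le (by rw [antichainCount_empty]; exact one_pos)
    (antichainCount_mono (empty_subset F))

variable [DecidableEq X]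

theorem antichainCount_union_le (F G : Finset X) :
    antichainCount (F ∪ G) ≤ antichainCount F * antichainCount G := by
  classical
  unfold antichainCount
  rw [← card_product]
  refine card_le_card_of_injOn (fun A => (A ∩ F, A ∩ G)) (fun A hA => ?_) fun A hA B hB h => ?_
  · simp only [coe_filter, mem_powerset, Set.mem_ofPred_eq] at hA
    simp only [coe_product, Set.mem_prod, coe_filter, mem_powerset, Set.mem_ofPred_eq]
    exact ⟨⟨inter_subset_right, hA.2.subset (by simp)⟩, inter_subset_right,
      hA.2.subset (by simp)⟩
  · simp only [coe_filter, mem_powerset, Set.mem_ofPred_eq] at hA hB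
    rw [Prod.mk.injEq] at h
    rw [← inter_eq_left.2 hA.1, ← inter_eq_left.2 hB.1, inter_union_distrib_left,
      inter_union_distrib_left, h.1, h.2]

theorem antichainCount_le_add [DecidableLT X] (F : Finset X) (x : X) :
    antichainCount F ≤ antichainCount (F.erase x) +
      antichainCount ({y ∈ F | ¬ x < y}.erase x) := by
  classical
  unfold antichainCount
  rw [← card_filter_add_card_filter_not
    (s := F.powerset.filter fun A : Finset X => IsAntichain (· ≤ ·) (A : Set X))
    (fun A => x ∉ A)]
  refine add_le_add (card_le_card fun A hA => ?_) (card_le_card_of_injOn (fun A => A.erase x)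
    (fun A hA => ?_) fun A hA B hB h => ?_)
  · simp only [mem_filter, mem_powerset] at hA ⊢
    exact ⟨subset_erase.2 ⟨hA.1.1, hA.2⟩, hA.1.2⟩
  · simp only [coe_filter, mem_filter, mem_powerset, Set.mem_ofPred_eq, not_not] at hA ⊢
    obtain ⟨⟨hAF, hA⟩, hxA⟩ := hA
    refine ⟨fun y hy => ?_, hA.subset (by simp)⟩
    have hyA := mem_of_mem_erase hy
    refine mem_erase.2 ⟨ne_of_mem_erase hy, mem_filter.2 ⟨hAF hyA, fun hlt => ?_⟩⟩
    exact hA hxA hyA hlt.ne hlt.le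
  · simp only [coe_filter, mem_filter, mem_powerset, Set.mem_ofPred_eq, not_not] at hA hB
    rw [← insert_erase hA.2, ← insert_erase hB.2]
    exact congrArg (insert x) h

/-- If every nonempty subset of `V` has an element with many elements above it, then the number of
antichains in `V` is bounded by a product. -/
theorem antichainCount_le_prod [DecidableLT X] {θ : ℕ → ℝ} (hθ0 : ∀ l, 0 ≤ θ l)
    (hθ : Antitone θ) {V : Finset X} (hV : ∀ F ⊆ V, F.Nonempty →
      ∃ x ∈ F, 1 ≤ θ #F * (1 + θ #F) ^ #{y ∈ F | x < y}) {F : Finset X} (hF : F ⊆ V) :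
    (antichainCount F : ℝ) ≤ ∏ l ∈ range #F, (1 + θ (l + 1)) := by
  induction hf : #F using Nat.strong_induction_on generalizing F with
  | _ f ih =>
  rcases F.eq_empty_or_nonempty with rfl | hne
  · rw [← hf]; simp [antichainCount_empty]
  obtain ⟨x, hx, hd⟩ := hV F hF hne
  set d := #{y ∈ F | x < y} with hd'
  have hf1 : #(F.erase x) = f - 1 := by rw [card_erase_of_mem hx, hf]
  have hpos : 0 < f := by rw [← hf]; exact card_pos.2 hne
  have hsplit : #{y ∈ F | x < y} + #{y ∈ F | ¬ x < y} = f := by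
    rw [card_filter_add_card_filter_not, hf]
  have hxm : x ∈ {y ∈ F | ¬ x < y} := mem_filter.2 ⟨hx, lt_irrefl x⟩
  have hf2 : #({y ∈ F | ¬ x < y}.erase x) = f - 1 - d := by
    rw [card_erase_of_mem hxm]; omega
  have hdf : d ≤ f - 1 := by have := card_pos.2 ⟨x, hxm⟩; omega
  have h1 := ih (f - 1) (by omega) ((erase_subset _ _).trans hF) hf1
  have h2 := ih (f - 1 - d) (by omega)
    (((erase_subset _ _).trans (filter_subset _ _)).trans hF) hf2
  have h3 : (antichainCount F : ℝ) ≤ antichainCount (F.erase x) +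
      antichainCount ({y ∈ F | ¬ x < y}.erase x) := by exact_mod_cast antichainCount_le_add F x
  have hP : ∀ g, 0 ≤ ∏ l ∈ range g, (1 + θ (l + 1)) := fun g =>
    prod_nonneg fun l _ => by linarith [hθ0 (l + 1)]
  have h4 : (∏ l ∈ range (f - 1 - d), (1 + θ (l + 1))) * (1 + θ f) ^ d ≤
      ∏ l ∈ range (f - 1), (1 + θ (l + 1)) := by
    rw [← prod_range_mul_prod_Ico _ (Nat.sub_le (f - 1) d)]
    refine mul_le_mul_of_nonneg_left ?_ (hP _)
    have : #(Ico (f - 1 - d) (f - 1)) = d := by rw [Nat.card_Ico]; omega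
    nth_rw 1 [← this]
    rw [← prod_const]
    refine prod_le_prod (fun l _ => by linarith [hθ0 f]) fun l hl => ?_
    have := hθ (show l + 1 ≤ f by rw [mem_Ico] at hl; omega)
    linarith
  rw [hf] at hd
  have h5 : ∏ l ∈ range (f - 1 - d), (1 + θ (l + 1)) ≤
      θ f * ∏ l ∈ range (f - 1), (1 + θ (l + 1)) := by
    calc ∏ l ∈ range (f - 1 - d), (1 + θ (l + 1))
        ≤ (∏ l ∈ range (f - 1 - d), (1 + θ (l + 1))) * (θ f * (1 + θ f) ^ d) :=
          le_mul_of_one_le_right (hP _) hd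
      _ = θ f * ((∏ l ∈ range (f - 1 - d), (1 + θ (l + 1))) * (1 + θ f) ^ d) := by ring
      _ ≤ _ := mul_le_mul_of_nonneg_left h4 (hθ0 f)
  have h6 : ∏ l ∈ range f, (1 + θ (l + 1)) =
      (∏ l ∈ range (f - 1), (1 + θ (l + 1))) * (1 + θ f) := by
    obtain ⟨g, rfl⟩ : ∃ g, f = g + 1 := ⟨f - 1, by omega⟩
    rw [prod_range_succ]; rfl
  rw [h6]
  linarith

/-- The weights used in the antichain count. -/
noncomputable def decayWeight (N E : ℝ) (l : ℕ) : ℝ := if l ≤ N + E then 1 else E / (l - N)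

theorem decayWeight_pos {N E : ℝ} (hE : 0 < E) (l : ℕ) : 0 < decayWeight N E l := by
  unfold decayWeight
  split_ifs with h
  · exact one_pos
  · exact div_pos hE (by linarith)

theorem decayWeight_le_one {N E : ℝ} (hE : 0 < E) (l : ℕ) : decayWeight N E l ≤ 1 := by
  unfold decayWeight
  split_ifs with h
  · exact le_rfl
  · rw [div_le_one (by linarith)]; linarith

theorem decayWeight_antitone {N E : ℝ} (hE : 0 < E) : Antitone (decayWeight N E) := by
  intro l l' h
  have hR : (l : ℝ) ≤ l' := by exact_mod_cast h
  by_cases hl : l ≤ N + E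
  · rw [decayWeight.eq_def N E l, if_pos hl]; exact decayWeight_le_one hE l'
  · unfold decayWeight
    rw [if_neg hl, if_neg (by linarith)]
    exact div_le_div_of_nonneg_left hE.le (by linarith) (by linarith)

theorem logb_one_add_le {x : ℝ} (hx : 0 ≤ x) : Real.logb 2 (1 + x) ≤ 2 * x := by
  have h2 := Real.log_two_gt_d9
  rw [Real.logb, div_le_iff₀ (by linarith)]
  have := Real.log_le_sub_one_of_pos (show 0 < 1 + x by linarith)
  nlinarith

/-- The product in the antichain count is `2` to the power `N` plus a small error. -/
theorem logb_prod_decayWeight_le {N E : ℝ} (hN : 0 ≤ N) (hE : 1 / 2 ≤ E) (f : ℕ) :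
    Real.logb 2 (∏ l ∈ range f, (1 + decayWeight N E (l + 1))) ≤
      N + E + if f ≤ N + E then 0 else 2 * E * (1 + Real.log ((f - N) / E)) := by
  have hE0 : 0 < E := by linarith
  have hpos : ∀ l, 0 < 1 + decayWeight N E l := fun l => by linarith [decayWeight_pos (N := N) hE0 l]
  have hcrude : ∀ f : ℕ, Real.logb 2 (∏ l ∈ range f, (1 + decayWeight N E (l + 1))) ≤ f := by
    intro f
    rw [Real.logb_le_iff_le_rpow one_lt_two (prod_pos fun l _ => hpos _), Real.rpow_natCast]
    calc ∏ l ∈ range f, (1 + decayWeight N E (l + 1)) ≤ ∏ _l ∈ range f, (2 : ℝ) :=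
          prod_le_prod (fun l _ => (hpos _).le) fun l _ => by
            linarith [decayWeight_le_one (N := N) hE0 (l + 1)]
      _ = 2 ^ f := by simp
  split_ifs with hf
  · linarith [hcrude f]
  · induction f with
    | zero => simp at hf; linarith
    | succ f ih =>
      push_cast at hf ⊢
      have hratio : 1 ≤ (f + 1 - N) / E := by rw [one_le_div hE0]; linarith
      by_cases hf' : f ≤ N + E
      · have := Real.log_nonneg hratio
        have := hcrude (f + 1)
        push_cast at this
        nlinarith
      · have hfN : 0 < f - N := by linarith
        have h := ih hf'
        rw [prod_range_succ, Real.logb_mul (prod_pos fun l _ => hpos _).ne' (hpos _).ne']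
        have hθ := logb_one_add_le (decayWeight_pos (N := N) hE0 (f + 1)).le
        have e : decayWeight N E (f + 1) = E / (f + 1 - N) := by
          unfold decayWeight; push_cast; rw [if_neg hf]
        rw [e] at hθ
        rw [e]
        have hlog : 1 / (f + 1 - N) ≤ Real.log ((f + 1 - N) / E) - Real.log ((f - N) / E) := by
          rw [Real.log_div (by linarith) hE0.ne', Real.log_div hfN.ne' hE0.ne']
          have h1 := Real.log_le_sub_one_of_pos
            (show 0 < (f - N) / (f + 1 - N) from div_pos hfN (by linarith))
          rw [Real.log_div hfN.ne' (by linarith)] at h1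
          have h2 : (f - N) / (f + 1 - N) - 1 = - (1 / (f + 1 - N)) := by
            have : f + 1 - N ≠ 0 := by linarith
            field_simp; ring
          linarith
        have h3 : 2 * (E / (f + 1 - N)) = 2 * E * (1 / (f + 1 - N)) := by ring
        nlinarith

/-- Supersaturation implies few antichains. -/
theorem logb_antichainCount_le [DecidableLT X] {N δ Λ : ℝ} (hN : 0 < N) (hδ : 0 < δ)
    (hΛ : 0 < Λ) (hE : 1 / 2 ≤ 2 * δ * Λ * N) {V : Finset X}
    (hV : ∀ F ⊆ V, F.Nonempty → ∃ x ∈ F, (#F / N - 1) / (2 * δ) ≤ #{y ∈ F | x < y}) {B : ℝ}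
    (hB : #V ≤ B * N) (hΛB : B ≤ 2 * δ * Λ * 2 ^ Λ) (hB1 : 2 * δ * Λ ≤ B) :
    Real.logb 2 (antichainCount V) ≤
      N + 2 * δ * Λ * N * (3 + 2 * Real.log (B / (2 * δ * Λ))) := by
  set E := 2 * δ * Λ * N with hEdef
  have hE0 : 0 < E := by linarith
  have hprod := antichainCount_le_prod (fun l => (decayWeight_pos (N := N) hE0 l).le)
    (decayWeight_antitone hE0) (V := V) (fun F hF hne => by
      obtain ⟨x, hx, hd⟩ := hV F hF hne
      refine ⟨x, hx, ?_⟩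
      set d := #{y ∈ F | x < y}
      set θ := decayWeight N E #F with hθ
      by_cases hf : #F ≤ N + E
      · have : θ = 1 := by rw [hθ, decayWeight, if_pos hf]
        rw [this]
        simpa using one_le_pow₀ (show (1 : ℝ) ≤ 1 + 1 by norm_num)
      · have hθe : θ = E / (#F - N) := by rw [hθ, decayWeight, if_neg hf]
        have hθ0 : 0 < θ := decayWeight_pos hE0 _
        have hθ1 : θ ≤ 1 := decayWeight_le_one hE0 _
        have hFN : 0 < #F - N := by linarith
        have hdΛ : Λ / θ ≤ d := by
          refine le_trans (le_of_eq ?_) hd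
          rw [hθe, hEdef]
          field_simp
        have h2 : (2 : ℝ) ≤ (1 + θ) ^ (1 / θ) := by
          have := one_add_mul_self_le_rpow_one_add (show -1 ≤ θ by linarith)
            (p := 1 / θ) (by rw [le_div_iff₀ hθ0]; linarith)
          rwa [one_div_mul_cancel hθ0.ne', one_add_one_eq_two] at this
        have h3 : (2 : ℝ) ^ Λ ≤ (1 + θ) ^ d := by
          calc (2 : ℝ) ^ Λ ≤ ((1 + θ) ^ (1 / θ)) ^ Λ :=
                Real.rpow_le_rpow zero_le_two h2 hΛ.le
            _ = (1 + θ) ^ (Λ / θ) := by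
                rw [← Real.rpow_mul (by linarith)]; congr 1; ring
            _ ≤ (1 + θ) ^ (d : ℝ) := Real.rpow_le_rpow_of_exponent_le (by linarith) hdΛ
            _ = (1 + θ) ^ d := Real.rpow_natCast _ _
        have h4 : 1 ≤ θ * 2 ^ Λ := by
          rw [hθe, div_mul_eq_mul_div, one_le_div hFN]
          have : (#F : ℝ) ≤ #V := by exact_mod_cast card_le_card hF
          nlinarith
        exact h4.trans (mul_le_mul_of_nonneg_left h3 hθ0.le)) (Subset.refl V)
  have h1 : Real.logb 2 (antichainCount V) ≤
      Real.logb 2 (∏ l ∈ range #V, (1 + decayWeight N E (l + 1))) :=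
    Real.logb_le_logb_of_le one_lt_two (by exact_mod_cast antichainCount_pos V) hprod
  refine h1.trans ((logb_prod_decayWeight_le hN.le hE _).trans ?_)
  have hδΛ : 0 < 2 * δ * Λ := by positivity
  have hlog0 : 0 ≤ Real.log (B / (2 * δ * Λ)) :=
    Real.log_nonneg (by rwa [one_le_div hδΛ])
  split_ifs with hf
  · nlinarith
  · have : Real.log ((#V - N) / E) ≤ Real.log (B / (2 * δ * Λ)) := by
      refine Real.log_le_log (div_pos (by linarith) hE0) ?_
      rw [div_le_div_iff₀ hE0 hδΛ]
      have : (#V - N) * (2 * δ * Λ) ≤ B * N * (2 * δ * Λ) :=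
        mul_le_mul_of_nonneg_right (by linarith) hδΛ.le
      rw [hEdef]; linarith
    nlinarith

end AntichainCount

section Slices

theorem antichainCount_biUnion_le {X ι : Type*} [PartialOrder X] [DecidableEq X] [DecidableEq ι]
    (U : Finset ι) (S : ι → Finset X) {c : ℕ} (hc : ∀ u ∈ U, antichainCount (S u) ≤ c) :
    antichainCount (U.biUnion S) ≤ c ^ #U := by
  induction U using Finset.induction_on with
  | empty => simp [antichainCount_empty]
  | insert u U hu ih =>
    rw [biUnion_insert, card_insert_of_notMem hu, pow_succ']
    exact (antichainCount_union_le _ _).trans (Nat.mul_le_mul (hc u (mem_insert_self _ _))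
      (ih fun v hv => hc v (mem_insert_of_mem hv)))

theorem antichainCount_planar_le {X : Type*} [PartialOrder X] [DecidableEq X] {t : ℕ}
    (f g : X → Fin t) (S : Finset X)
    (h : ∀ x ∈ S, ∀ y ∈ S, x ≤ y ↔ f x ≤ f y ∧ g x ≤ g y) : antichainCount S ≤ 4 ^ t := by
  classical
  have hcomp : ∀ A ⊆ S, IsAntichain (· ≤ ·) (A : Set X) → ∀ x ∈ A, ∀ y ∈ A,
      (f x < f y ↔ g y < g x) ∧ (f x = f y → x = y) ∧ (g x = g y → x = y) := by
    intro A hAS hA x hx y hy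
    by_cases hxy : x = y
    · subst hxy; simp
    · have h1 : ¬ x ≤ y := hA hx hy hxy
      have h2 : ¬ y ≤ x := hA hy hx (Ne.symm hxy)
      rw [h x (hAS hx) y (hAS hy)] at h1
      rw [h y (hAS hy) x (hAS hx)] at h2
      simp only [Fin.le_def, Fin.lt_def, Fin.ext_iff] at *
      omega
  have hrank : ∀ A ⊆ S, IsAntichain (· ≤ ·) (A : Set X) → ∀ x ∈ A,
      #{p ∈ A.image f | p < f x} = #{q ∈ A.image g | g x < q} := by
    intro A hAS hA x hx
    have hc := hcomp A hAS hA
    rw [filter_image, filter_image, card_image_of_injOn, card_image_of_injOn]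
    · exact congrArg card (filter_congr fun y hy => (hc y hy x hx).1)
    · exact fun y hy z hz => (hc y (mem_of_mem_filter y hy) z (mem_of_mem_filter z hz)).2.2
    · exact fun y hy z hz => (hc y (mem_of_mem_filter y hy) z (mem_of_mem_filter z hz)).2.1
  have hsub : ∀ A ⊆ S, IsAntichain (· ≤ ·) (A : Set X) → ∀ B ⊆ S,
      IsAntichain (· ≤ ·) (B : Set X) → A.image f = B.image f → A.image g = B.image g →
      A ⊆ B := by
    intro A hAS hA B hBS hB hf hg a ha
    obtain ⟨b, hb, hba⟩ := mem_image.1 (hf ▸ mem_image_of_mem f ha)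
    have e : #{q ∈ B.image g | g a < q} = #{q ∈ B.image g | g b < q} := by
      rw [← hrank B hBS hB b hb, ← hg, ← hrank A hAS hA a ha, hf, hba]
    have hgab : g a = g b := by
      rcases lt_trichotomy (g a) (g b) with hlt | heq | hlt
      · refine absurd e (ne_of_gt (card_lt_card ⟨fun q hq => ?_, fun hcon => ?_⟩))
        · rw [mem_filter] at hq ⊢; exact ⟨hq.1, hlt.trans hq.2⟩
        · exact lt_irrefl _ (mem_filter.1 (hcon (mem_filter.2 ⟨mem_image_of_mem g hb, hlt⟩))).2
      · exact heq
      · refine absurd e (ne_of_lt (card_lt_card ⟨fun q hq => ?_, fun hcon => ?_⟩))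
        · rw [mem_filter] at hq ⊢; exact ⟨hq.1, hlt.trans hq.2⟩
        · exact lt_irrefl _ (mem_filter.1 (hcon (mem_filter.2
            ⟨hg ▸ mem_image_of_mem g ha, hlt⟩))).2
    have : a = b := le_antisymm ((h a (hAS ha) b (hBS hb)).2 ⟨hba.ge, hgab.le⟩)
      ((h b (hBS hb) a (hAS ha)).2 ⟨hba.le, hgab.ge⟩)
    rwa [this]
  have hcard : #(univ : Finset (Finset (Fin t) × Finset (Fin t))) = 4 ^ t := by
    rw [card_univ, Fintype.card_prod, Fintype.card_finset, Fintype.card_fin, ← mul_pow]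
    norm_num
  rw [← hcard]
  refine card_le_card_of_injOn (fun A => (A.image f, A.image g)) (fun _ _ => mem_coe.2 (mem_univ _))
    fun A hA B hB hAB => ?_
  simp only [coe_filter, mem_powerset, Set.mem_ofPred_eq] at hA hB
  rw [Prod.mk.injEq] at hAB
  exact (hsub A hA.1 hA.2 B hB.1 hB.2 hAB.1 hAB.2).antisymm
    (hsub B hB.1 hB.2 A hA.1 hA.2 hAB.1.symm hAB.2.symm)

variable {t m : ℕ}

theorem antichainCount_slices_le (E : Finset (Fin (m + 2) → Fin t)) (U : Finset (Fin m → Fin t))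
    (h : ∀ x ∈ E, (fun i => x (Fin.succ (Fin.succ i))) ∈ U) :
    antichainCount E ≤ (4 ^ t) ^ #U := by
  classical
  have hE : E ⊆ U.biUnion fun u => {x ∈ E | (fun i => x (Fin.succ (Fin.succ i))) = u} :=
    fun x hx => mem_biUnion.2 ⟨_, h x hx, mem_filter.2 ⟨hx, rfl⟩⟩
  refine (antichainCount_mono hE).trans (antichainCount_biUnion_le _ _ fun u _ => ?_)
  refine antichainCount_planar_le (fun x => x 0) (fun x => x 1) _ fun x hx y hy => ?_
  have e : ∀ i : Fin m, x (Fin.succ (Fin.succ i)) = y (Fin.succ (Fin.succ i)) := fun i =>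
    (congrFun (mem_filter.1 hx).2 i).trans (congrFun (mem_filter.1 hy).2 i).symm
  refine ⟨fun hxy => ⟨hxy 0, hxy 1⟩, fun ⟨h0, h1⟩ i => ?_⟩
  refine Fin.cases h0 (fun i => ?_) i
  exact Fin.cases h1 (fun i => (e i).le) i

theorem antichainCount_univ_le {n : ℕ} (hn : 2 ≤ n) :
    antichainCount (univ : Finset (Fin n → Fin t)) ≤ 4 ^ t ^ (n - 1) := by
  obtain ⟨m, rfl⟩ : ∃ m, n = m + 2 := ⟨n - 2, by omega⟩
  refine (antichainCount_slices_le univ univ fun x _ => mem_univ _).trans (le_of_eq ?_)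
  rw [card_univ, Fintype.card_fun, Fintype.card_fin, Fintype.card_fin, ← pow_mul,
    show m + 2 - 1 = m + 1 by omega, pow_succ']

theorem sum_exp_centered_le (t : ℕ) (r : ℝ) :
    ∑ v : Fin t, Real.exp (r * ((2 * (v : ℝ) - (t - 1)) / t)) ≤ t * Real.exp (r ^ 2 / 2) := by
  set s : Fin t → ℝ := fun v => (2 * (v : ℝ) - (t - 1)) / t with hs
  have hrev : ∀ v, s (Fin.rev v) = - s v := by
    intro v
    simp only [hs]
    rw [Fin.val_rev, Nat.cast_sub (by omega)]
    push_cast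
    ring
  have h1 : ∑ v, Real.exp (r * s v) = ∑ v, Real.exp (-(r * s v)) := by
    rw [← Equiv.sum_comp Fin.revPerm]
    exact sum_congr rfl fun v _ => by rw [Fin.revPerm_apply, hrev, mul_neg]
  have h2 : ∑ v, Real.exp (r * s v) = ∑ v, Real.cosh (r * s v) := by
    have : ∑ v, Real.cosh (r * s v) =
        (∑ v, Real.exp (r * s v) + ∑ v, Real.exp (-(r * s v))) / 2 := by
      rw [← sum_add_distrib, sum_div]
      exact sum_congr rfl fun v _ => Real.cosh_eq _
    rw [this, ← h1]; ring
  rw [h2]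
  calc ∑ v, Real.cosh (r * s v) ≤ ∑ _v : Fin t, Real.exp (r ^ 2 / 2) := by
        refine sum_le_sum fun v _ => (Real.cosh_le_exp_half_sq _).trans (Real.exp_le_exp.2 ?_)
        have ht : (0 : ℝ) < t := by have := v.2; exact_mod_cast (by omega : 0 < t)
        have hv : (v : ℝ) + 1 ≤ t := by exact_mod_cast v.2
        have hsv : |s v| ≤ 1 := by
          simp only [hs]
          rw [abs_div, abs_of_pos ht, div_le_one ht, abs_le]
          have : (0 : ℝ) ≤ (v : ℝ) := by positivity
          constructor <;> linarith
        rw [mul_pow]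
        have := (sq_le_one_iff_abs_le_one (s v)).2 hsv
        nlinarith [sq_nonneg r]
    _ = t * Real.exp (r ^ 2 / 2) := by simp

/-- Few points of `[t]^m` have rank far from the middle. -/
theorem card_far_le (ht : 1 ≤ t) (m : ℕ) :
    (#{u : Fin m → Fin t | (m * t / 64 : ℝ) ≤ |(gridRank u : ℝ) - m * (t - 1) / 2|} : ℝ) ≤
      2 * t ^ m * Real.exp (-(m / 2048)) := by
  have htR : (0 : ℝ) < t := by exact_mod_cast ht
  set Y : (Fin m → Fin t) → ℝ := fun u => ∑ i, (2 * ((u i : ℕ) : ℝ) - (t - 1)) / t with hY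
  have hYr : ∀ u, Y u * t / 2 = (gridRank u : ℝ) - m * (t - 1) / 2 := by
    intro u
    rw [hY]
    simp only
    rw [← sum_div, div_mul_cancel₀ _ htR.ne', sum_sub_distrib, ← mul_sum, gridRank]
    push_cast
    simp
    ring
  have hexp : ∀ r : ℝ, ∑ u, Real.exp (r * Y u) ≤ t ^ m * Real.exp (m * (r ^ 2 / 2)) := by
    intro r
    have e : ∑ u, Real.exp (r * Y u) =
        (∑ v : Fin t, Real.exp (r * ((2 * (v : ℝ) - (t - 1)) / t))) ^ m := by
      rw [Fintype.sum_pow]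
      refine sum_congr rfl fun u _ => ?_
      rw [← Real.exp_sum, hY, mul_sum]
    rw [e, Real.exp_nat_mul, ← mul_pow]
    exact pow_le_pow_left₀ (sum_nonneg fun _ _ => (Real.exp_pos _).le) (sum_exp_centered_le t r) m
  have h1 : (#{u : Fin m → Fin t | (m * t / 64 : ℝ) ≤ |(gridRank u : ℝ) - m * (t - 1) / 2|} : ℝ) *
      Real.exp (m / 1024) ≤ ∑ u, (Real.exp (1 / 32 * Y u) + Real.exp (-(1 / 32) * Y u)) := by
    rw [← nsmul_eq_mul, ← sum_const]
    refine (sum_le_sum fun u hu => ?_).trans (sum_le_sum_of_subset_of_nonneg (subset_univ _)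
      fun _ _ _ => by positivity)
    have hu := (mem_filter.1 hu).2
    rw [← hYr, abs_div, abs_mul, abs_of_pos htR, abs_two] at hu
    have hYu : (m : ℝ) / 32 ≤ |Y u| := by
      have : (m / 32 : ℝ) * t ≤ |Y u| * t := by linarith
      exact le_of_mul_le_mul_right this htR
    rcases le_abs.1 hYu with h | h
    · have := Real.exp_le_exp.2 (show (m : ℝ) / 1024 ≤ 1 / 32 * Y u by linarith)
      have := Real.exp_pos (-(1 / 32) * Y u)
      linarith
    · have := Real.exp_le_exp.2 (show (m : ℝ) / 1024 ≤ -(1 / 32) * Y u by linarith)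
      have := Real.exp_pos (1 / 32 * Y u)
      linarith
  rw [sum_add_distrib] at h1
  have h2 := hexp (1 / 32)
  have h3 := hexp (-(1 / 32))
  rw [neg_sq] at h3
  have e1 : (m : ℝ) * ((1 / 32) ^ 2 / 2) = m / 2048 := by ring
  rw [e1] at h2 h3
  have e2 : Real.exp (m / 1024 : ℝ) = Real.exp (m / 2048) * Real.exp (m / 2048) := by
    rw [← Real.exp_add]; congr 1; ring
  rw [e2] at h1
  have hp := Real.exp_pos (m / 2048 : ℝ)
  rw [Real.exp_neg, ← div_eq_mul_inv, le_div_iff₀ hp]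
  refine le_of_mul_le_mul_right ?_ hp
  linarith

open scoped Classical in
/-- The points of `[t]^n` whose rank is near the middle. -/
noncomputable def middlePoints (t n : ℕ) : Finset (Fin n → Fin t) :=
  univ.filter fun x => MiddleRank t n (gridRank x)

theorem mem_middlePoints {n : ℕ} {x : Fin n → Fin t} :
    x ∈ middlePoints t n ↔ MiddleRank t n (gridRank x) := by
  simp [middlePoints]

theorem logb_antichainCount_compl_middle_le (ht : 1 ≤ t) {n : ℕ} (hn : 64 ≤ n) :
    Real.logb 2 (antichainCount (middlePoints t n)ᶜ) ≤
      8 * 4096 ^ 2 * (t ^ (n - 1) / (n : ℝ) ^ 2) := by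
  obtain ⟨m, rfl⟩ : ∃ m, n = m + 2 := ⟨n - 2, by omega⟩
  have htR : (1 : ℝ) ≤ t := by exact_mod_cast ht
  have hm : (62 : ℝ) ≤ m := by exact_mod_cast (by omega : 62 ≤ m)
  set U : Finset (Fin m → Fin t) :=
    {u : Fin m → Fin t | (m * t / 64 : ℝ) ≤ |(gridRank u : ℝ) - m * (t - 1) / 2|} with hU
  have h1 := antichainCount_slices_le (middlePoints t (m + 2))ᶜ U (by
    intro x hx
    rw [mem_compl, mem_middlePoints] at hx
    unfold MiddleRank at hx
    rw [hU, mem_filter]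
    refine ⟨mem_univ _, ?_⟩
    have e : gridRank x = x 0 + (x 1 + gridRank fun i => x (Fin.succ (Fin.succ i))) := by
      unfold gridRank; rw [Fin.sum_univ_succ, Fin.sum_univ_succ]; rfl
    rw [e] at hx
    have h0 : ((x 0 : ℕ) : ℝ) + 1 ≤ t := by exact_mod_cast (x 0).2
    have h1 : ((x 1 : ℕ) : ℝ) + 1 ≤ t := by exact_mod_cast (x 1).2
    have h0' : (0 : ℝ) ≤ (x 0 : ℕ) := by positivity
    have h1' : (0 : ℝ) ≤ (x 1 : ℕ) := by positivity
    push_cast at hx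
    by_contra hcon
    rw [not_le, abs_lt] at hcon
    refine hx (abs_le.2 ⟨?_, ?_⟩) <;> nlinarith [hcon.1, hcon.2])
  have h2 := card_far_le ht m
  rw [← hU] at h2
  have h3 : Real.logb 2 (antichainCount (middlePoints t (m + 2))ᶜ) ≤ 2 * t * #U := by
    rw [Real.logb_le_iff_le_rpow one_lt_two (by exact_mod_cast antichainCount_pos _)]
    have : ((2 : ℝ) ^ (2 * t * #U : ℝ)) = ((4 ^ t) ^ #U : ℕ) := by
      rw [← pow_mul]
      push_cast
      rw [show (4 : ℝ) = 2 ^ 2 by norm_num, ← pow_mul, ← Real.rpow_natCast]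
      congr 1
      push_cast
      ring
    rw [this]
    exact_mod_cast h1
  refine h3.trans ?_
  have h4 : Real.exp (-(m / 2048)) ≤ 2 * 4096 ^ 2 / (m + 2 : ℝ) ^ 2 := by
    have hq := Real.quadratic_le_exp_of_nonneg (show (0 : ℝ) ≤ m / 2048 by positivity)
    rw [Real.exp_neg, inv_eq_one_div, div_le_div_iff₀ (Real.exp_pos _) (by positivity)]
    nlinarith
  have h5 : (2 * t * #U : ℝ) ≤ 2 * t * (2 * t ^ m * (2 * 4096 ^ 2 / (m + 2 : ℝ) ^ 2)) := by
    refine mul_le_mul_of_nonneg_left (h2.trans ?_) (by positivity)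
    exact mul_le_mul_of_nonneg_left h4 (by positivity)
  refine h5.trans (le_of_eq ?_)
  rw [show m + 2 - 1 = m + 1 by omega, pow_succ]
  push_cast
  ring

end Slices

section Bridge

variable {t n : ℕ}

theorem layerSize_eq_layerCount (t n k : ℕ) : (layerSize t n k : ℝ) = layerCount t n k := by
  rw [← card_gridRank_eq, layerSize, Fintype.card_subtype]
  simp only [gridRank, Nat.cast_inj]

theorem layerSize_le_maxLayer {k : ℕ} (hk : k ≤ n * t) : layerSize t n k ≤ maxLayer t n :=
  le_sup (f := fun k => layerSize t n k) (mem_range.2 (Nat.lt_succ_of_le hk))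

theorem pow_pred_le_mul_maxLayer (ht : 1 ≤ t) (hn : 1 ≤ n) :
    (t : ℝ) ^ (n - 1) ≤ n * maxLayer t n := by
  have h : #(univ : Finset (Fin n → Fin t)) ≤ maxLayer t n * #(range (n * (t - 1) + 1)) := by
    refine card_le_mul_card_image_of_maps_to (f := gridRank)
      (fun x _ => mem_range.2 (Nat.lt_succ_of_le (gridRank_le x))) _ fun k hk => ?_
    have hk : k ≤ n * t := (Nat.le_of_lt_succ (mem_range.1 hk)).trans
      (Nat.mul_le_mul_left n (Nat.sub_le t 1))
    refine le_trans (le_of_eq ?_) (layerSize_le_maxLayer hk)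
    rw [layerSize, Fintype.card_subtype]
    rfl
  rw [card_univ, Fintype.card_fun, Fintype.card_fin, Fintype.card_fin, card_range] at h
  have h2 : n * (t - 1) + 1 ≤ n * t := by
    obtain ⟨s, rfl⟩ : ∃ s, t = s + 1 := ⟨t - 1, by omega⟩
    rw [Nat.add_sub_cancel, mul_add]
    omega
  obtain ⟨m, rfl⟩ : ∃ m, n = m + 1 := ⟨n - 1, by omega⟩
  rw [Nat.add_sub_cancel]
  norm_cast
  refine Nat.le_of_mul_le_mul_right (c := t) ?_ ht
  calc t ^ m * t = t ^ (m + 1) := (pow_succ t m).symm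
    _ ≤ maxLayer t (m + 1) * ((m + 1) * t) := h.trans (Nat.mul_le_mul_left _ h2)
    _ = _ := by ring

theorem alphaT_eq_antichainCount (t n : ℕ) :
    alphaT t n = antichainCount (univ : Finset (Fin n → Fin t)) := by
  classical
  rw [alphaT, Nat.card_eq_fintype_card, Fintype.card_subtype, antichainCount, powerset_univ]

theorem one_le_flowConst : 1 ≤ flowConst := by
  unfold flowConst shareConst
  norm_num

theorem middlePoints_exists_many_above (ht : 2 ≤ t) (hn : 16 ≤ n)
    [DecidableLT (Fin n → Fin t)] {F : Finset (Fin n → Fin t)} (hF : F ⊆ middlePoints t n)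
    (hne : F.Nonempty) :
    ∃ x ∈ F, ((#F : ℝ) / maxLayer t n - 1) / (2 * (flowConst * (1 + Real.log n) / n)) ≤
      #{y ∈ F | x < y} := by
  have hn1 : (1 : ℝ) ≤ n := by exact_mod_cast (by omega : 1 ≤ n)
  refine (gridKernel_uniform (t := t) (n := n) (by omega)).exists_many_above (G := MiddleRank t n)
    ?_ (fun z y hy => gridKernel_le ht hn z y hy) hne (fun x _ => gridRank_le x)
    (fun x hx => mem_middlePoints.1 (hF hx)) fun x _ => ?_
  · have := Real.log_nonneg hn1
    have := one_le_flowConst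
    positivity
  · rw [← layerSize_eq_layerCount]
    exact_mod_cast layerSize_le_maxLayer ((gridRank_le x).trans
      (Nat.mul_le_mul_left n (Nat.sub_le t 1)))

end Bridge

section Coarse

variable {t n : ℕ}

/-- The coarsening `x ↦ ⌊x / 2⌋` of the grid. -/
def halve (x : Fin n → Fin t) : Fin n → Fin ((t + 1) / 2) :=
  fun i => ⟨x i / 2, by have := (x i).2; omega⟩

open scoped Classical in
/-- The points compatible with an antichain whose halved points have maximal elements `C`. -/
noncomputable def coarseRegion (C : Finset (Fin n → Fin ((t + 1) / 2))) :
    Finset (Fin n → Fin t) :=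
  univ.filter fun x => (∃ w ∈ C, halve x ≤ w) ∧ ∀ w ∈ C, ¬ ∀ i, halve x i < w i

theorem mem_coarseRegion {C : Finset (Fin n → Fin ((t + 1) / 2))} {x : Fin n → Fin t} :
    x ∈ coarseRegion C ↔ (∃ w ∈ C, halve x ≤ w) ∧ ∀ w ∈ C, ¬ ∀ i, halve x i < w i := by
  simp [coarseRegion]

theorem exists_subset_coarseRegion (hn : 1 ≤ n) {A : Finset (Fin n → Fin t)}
    (hA : IsAntichain (· ≤ ·) (A : Set (Fin n → Fin t))) :
    ∃ C : Finset (Fin n → Fin ((t + 1) / 2)),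
      IsAntichain (· ≤ ·) (C : Set (Fin n → Fin ((t + 1) / 2))) ∧
      A ⊆ coarseRegion C := by
  classical
  refine ⟨(A.image halve).filter fun w => Maximal (· ∈ A.image halve) w, ?_, fun x hx => ?_⟩
  · refine (setOfPred_maximal_antichain (· ∈ A.image halve)).subset fun w hw => ?_
    exact (mem_filter.1 hw).2
  · refine mem_coarseRegion.2 ⟨?_, fun w hw hlt => ?_⟩
    · obtain ⟨w, hxw, hw⟩ := (A.image halve).exists_le_maximal (mem_image_of_mem halve hx)
      exact ⟨w, mem_filter.2 ⟨hw.prop, hw⟩, hxw⟩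
    · obtain ⟨y, hy, rfl⟩ := mem_image.1 (mem_filter.1 hw).1
      have h : ∀ i, (x i : ℕ) < y i := fun i => by
        have : (x i : ℕ) / 2 < y i / 2 := hlt i
        omega
      refine hA hx hy ?_ fun i => (h i).le
      rintro rfl
      exact lt_irrefl _ (h ⟨0, hn⟩)

theorem antichainCount_univ_le_mul (hn : 1 ≤ n) {M : ℕ}
    (hM : ∀ C : Finset (Fin n → Fin ((t + 1) / 2)), antichainCount (coarseRegion (t := t) C) ≤ M) :
    antichainCount (univ : Finset (Fin n → Fin t)) ≤
      antichainCount (univ : Finset (Fin n → Fin ((t + 1) / 2))) * M := by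
  classical
  unfold antichainCount at hM ⊢
  refine le_trans (card_le_card (t := ((univ : Finset (Fin n → Fin ((t + 1) / 2))).powerset.filter
    fun C : Finset _ => IsAntichain (· ≤ ·) (C : Set (Fin n → Fin ((t + 1) / 2)))).biUnion fun C =>
      (coarseRegion (t := t) C).powerset.filter fun A : Finset _ =>
        IsAntichain (· ≤ ·) (A : Set (Fin n → Fin t))) ?_)
    (card_biUnion_le_card_mul _ _ _ fun C _ => ?_)
  · intro A hA
    have hA := (mem_filter.1 hA).2
    obtain ⟨C, hC, hAC⟩ := exists_subset_coarseRegion hn hA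
    exact mem_biUnion.2 ⟨C, mem_filter.2 ⟨mem_powerset.2 (subset_univ C), hC⟩,
      mem_filter.2 ⟨mem_powerset.2 hAC, hA⟩⟩
  · convert hM C

/-- The smallest coordinate of a point. -/
def minCoord (hn : 1 ≤ n) (x : Fin n → Fin t) : ℕ :=
  univ.inf' ⟨⟨0, hn⟩, mem_univ _⟩ fun i => (x i : ℕ)

/-- The lowest point on the diagonal line through a point. -/
def diagonalBase (hn : 1 ≤ n) (x : Fin n → Fin t) : Fin n → Fin t :=
  fun i => ⟨x i - minCoord hn x, (Nat.sub_le _ _).trans_lt (x i).2⟩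

theorem minCoord_le (hn : 1 ≤ n) (x : Fin n → Fin t) (i : Fin n) : minCoord hn x ≤ x i :=
  inf'_le (fun i => (x i : ℕ)) (mem_univ i)

theorem card_exists_eq_zero_le (t n : ℕ) :
    #{z : Fin n → Fin t | ∃ i, (z i : ℕ) = 0} ≤ n * t ^ (n - 1) := by
  classical
  have h : ∀ i : Fin n, #{z : Fin n → Fin t | (z i : ℕ) = 0} ≤ t ^ (n - 1) := by
    intro i
    have e : #(univ : Finset ({j : Fin n // j ≠ i} → Fin t)) = t ^ (n - 1) := by
      rw [card_univ, Fintype.card_fun, Fintype.card_fin, Fintype.card_subtype_compl,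
        Fintype.card_subtype_eq, Fintype.card_fin]
    rw [← e]
    refine card_le_card_of_injOn (fun z j => z j) (fun _ _ => mem_coe.2 (mem_univ _))
      fun z hz w hw hzw => funext fun j => ?_
    by_cases hj : j = i
    · subst hj
      exact Fin.ext ((mem_filter.1 hz).2.trans (mem_filter.1 hw).2.symm)
    · exact congrFun hzw ⟨j, hj⟩
  calc #{z : Fin n → Fin t | ∃ i, (z i : ℕ) = 0}
      ≤ #((univ : Finset (Fin n)).biUnion fun i => {z : Fin n → Fin t | (z i : ℕ) = 0}) := by
        refine card_le_card fun z hz => ?_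
        obtain ⟨i, hi⟩ := (mem_filter.1 hz).2
        exact mem_biUnion.2 ⟨i, mem_univ i, mem_filter.2 ⟨mem_univ z, hi⟩⟩
    _ ≤ #(univ : Finset (Fin n)) * t ^ (n - 1) := card_biUnion_le_card_mul _ _ _ fun i _ => h i
    _ = n * t ^ (n - 1) := by rw [card_univ, Fintype.card_fin]

theorem card_coarseRegion_le (hn : 1 ≤ n) (C : Finset (Fin n → Fin ((t + 1) / 2))) :
    #(coarseRegion (t := t) C) ≤ 2 * n * t ^ (n - 1) := by
  classical
  have hapart : ∀ x ∈ coarseRegion (t := t) C, ∀ y ∈ coarseRegion (t := t) C,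
      diagonalBase hn x = diagonalBase hn y → minCoord hn x % 2 = minCoord hn y % 2 →
      ¬ minCoord hn x < minCoord hn y := by
    intro x hx y hy hb hp hlt
    obtain ⟨w, hw, hyw⟩ := (mem_coarseRegion.1 hy).1
    refine (mem_coarseRegion.1 hx).2 w hw fun i => lt_of_lt_of_le ?_ (hyw i)
    have h1 : (x i : ℕ) - minCoord hn x = y i - minCoord hn y :=
      congrArg Fin.val (congrFun hb i)
    have h2 := minCoord_le hn x i
    have h3 := minCoord_le hn y i
    change (x i : ℕ) / 2 < y i / 2
    omega
  calc #(coarseRegion (t := t) C)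
      ≤ #(({z : Fin n → Fin t | ∃ i, (z i : ℕ) = 0} : Finset _) ×ˢ range 2) := by
        refine card_le_card_of_injOn (fun x => (diagonalBase hn x, minCoord hn x % 2))
          (fun x _ => mem_coe.2 (mem_product.2 ⟨mem_filter.2 ⟨mem_univ _, ?_⟩,
            mem_range.2 (Nat.mod_lt _ two_pos)⟩)) fun x hx y hy hxy => ?_
        · obtain ⟨i, -, hi⟩ := exists_mem_eq_inf' (⟨⟨0, hn⟩, mem_univ _⟩ : univ.Nonempty)
            fun i => (x i : ℕ)
          exact ⟨i, by simp [diagonalBase, minCoord, hi]⟩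
        · rw [Prod.mk.injEq] at hxy
          have hm : minCoord hn x = minCoord hn y :=
            le_antisymm (not_lt.1 (hapart y hy x hx hxy.1.symm hxy.2.symm))
              (not_lt.1 (hapart x hx y hy hxy.1 hxy.2))
          refine funext fun i => Fin.ext ?_
          have h1 : (x i : ℕ) - minCoord hn x = y i - minCoord hn y :=
            congrArg Fin.val (congrFun hxy.1 i)
          have h2 := minCoord_le hn x i
          have h3 := minCoord_le hn y i
          omega
    _ ≤ 2 * n * t ^ (n - 1) := by
        rw [card_product, card_range]
        have := card_exists_eq_zero_le t n
        nlinarith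

end Coarse

section Final

variable {t n : ℕ}

theorem logb_antichainCount_univ_le (t : ℕ) (hn : 2 ≤ n) :
    Real.logb 2 (antichainCount (univ : Finset (Fin n → Fin t))) ≤ 2 * t ^ (n - 1) := by
  rw [Real.logb_le_iff_le_rpow one_lt_two (by exact_mod_cast antichainCount_pos _)]
  have h : (2 : ℝ) ^ (2 * t ^ (n - 1) : ℝ) = (4 ^ t ^ (n - 1) : ℕ) := by
    push_cast
    rw [show (4 : ℝ) = 2 ^ 2 by norm_num, ← pow_mul]
    exact_mod_cast Real.rpow_natCast 2 (2 * t ^ (n - 1))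
  rw [h]
  exact_mod_cast antichainCount_univ_le hn

theorem sq_mul_three_pow_le {n : ℕ} (hn : 64 ≤ n) : n ^ 2 * 3 ^ (n - 1) ≤ 4 ^ (n - 1) := by
  induction n, hn using Nat.le_induction with
  | base => norm_num
  | succ k hk ih =>
    obtain ⟨m, rfl⟩ : ∃ m, k = m + 1 := ⟨k - 1, by omega⟩
    simp only [Nat.add_sub_cancel] at ih ⊢
    rw [pow_succ 3, pow_succ 4]
    have h : (m + 1 + 1) ^ 2 * 3 ≤ (m + 1) ^ 2 * 4 := by nlinarith
    calc (m + 1 + 1) ^ 2 * (3 ^ m * 3) = (m + 1 + 1) ^ 2 * 3 * 3 ^ m := by ring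
      _ ≤ (m + 1) ^ 2 * 4 * 3 ^ m := Nat.mul_le_mul_right _ h
      _ = (m + 1) ^ 2 * 3 ^ m * 4 := by ring
      _ ≤ 4 ^ m * 4 := Nat.mul_le_mul_right _ ih

theorem half_pow_pred_le (ht : 2 ≤ t) (hn : 64 ≤ n) :
    (((t + 1) / 2 : ℕ) : ℝ) ^ (n - 1) ≤ t ^ (n - 1) / (n : ℝ) ^ 2 := by
  have hn0 : (0 : ℝ) < n := by exact_mod_cast (by omega : 0 < n)
  have hs : (((t + 1) / 2 : ℕ) : ℝ) * 4 ≤ t * 3 := by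
    exact_mod_cast (by omega : (t + 1) / 2 * 4 ≤ t * 3)
  have h1 := pow_le_pow_left₀ (by positivity) hs (n - 1)
  rw [mul_pow, mul_pow] at h1
  have h2 : (n : ℝ) ^ 2 * 3 ^ (n - 1) ≤ 4 ^ (n - 1) := by exact_mod_cast sq_mul_three_pow_le hn
  rw [le_div_iff₀ (by positivity)]
  refine le_of_mul_le_mul_right (a := (3 : ℝ) ^ (n - 1)) ?_ (by positivity)
  calc _ = (((t + 1) / 2 : ℕ) : ℝ) ^ (n - 1) * ((n : ℝ) ^ 2 * 3 ^ (n - 1)) := by ring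
    _ ≤ (((t + 1) / 2 : ℕ) : ℝ) ^ (n - 1) * 4 ^ (n - 1) := by gcongr
    _ ≤ _ := h1

theorem logb_antichainCount_inter_middle_le (ht : 2 ≤ t) (hn : 64 ≤ n)
    {V : Finset (Fin n → Fin t)} (hVm : V ⊆ middlePoints t n) (hV : #V ≤ 2 * n * t ^ (n - 1)) :
    Real.logb 2 (antichainCount V) ≤
      (1 + 108 * flowConst * Real.logb 2 n ^ 3 / n) * maxLayer t n := by
  classical
  have hK := one_le_flowConst
  have hnR : (64 : ℝ) ≤ n := by exact_mod_cast hn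
  have hn0 : (0 : ℝ) < n := by linarith
  set K := flowConst
  set N : ℝ := (maxLayer t n : ℝ)
  set L := Real.logb 2 n with hL
  have hL1 : 1 ≤ L := by
    rw [hL, Real.le_logb_iff_rpow_le one_lt_two hn0]
    norm_num
    linarith
  have hlog0 : 0 ≤ Real.log n := Real.log_nonneg (by linarith)
  have hlogL : Real.log n ≤ L := by
    rw [hL, Real.logb, le_div_iff₀ (Real.log_pos one_lt_two)]
    have := Real.log_two_lt_d9
    nlinarith
  have hLn : L ≤ n := by
    rw [hL, Real.logb_le_iff_le_rpow one_lt_two hn0, Real.rpow_natCast]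
    exact_mod_cast Nat.lt_two_pow_self.le
  have hpN : (t : ℝ) ^ (n - 1) ≤ n * N :=
    pow_pred_le_mul_maxLayer (by omega) (by omega)
  have htwo : (n : ℝ) ^ 2 ≤ t ^ (n - 1) := by
    have h1 : n ^ 2 * 3 ^ (n - 1) ≤ t ^ (n - 1) * 3 ^ (n - 1) := by
      rw [← mul_pow]
      exact (sq_mul_three_pow_le hn).trans (Nat.pow_le_pow_left (by omega) _)
    exact_mod_cast Nat.le_of_mul_le_mul_right h1 (by positivity)
  have hnN : (n : ℝ) ≤ N := by
    refine le_of_mul_le_mul_left (a := (n : ℝ)) ?_ hn0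
    nlinarith
  have hN0 : 0 < N := by linarith
  set δ := K * (1 + Real.log n) / n with hδ
  have hδ1 : K / n ≤ δ := by
    rw [hδ]
    gcongr
    nlinarith
  have hδ2 : δ ≤ 2 * K * L / n := by
    rw [hδ]
    refine div_le_div_of_nonneg_right ?_ hn0.le
    nlinarith
  have hδ0 : 0 < δ := lt_of_lt_of_le (by positivity) hδ1
  have hpow : (2 : ℝ) ^ (3 * L) = n ^ 3 := by
    rw [mul_comm, Real.rpow_mul two_pos.le, hL, Real.rpow_logb two_pos (by norm_num) hn0]
    exact_mod_cast Real.rpow_natCast (n : ℝ) 3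
  have hE1 : K ≤ δ * n := (div_le_iff₀ hn0).1 hδ1
  have hE2 : δ * n ≤ 2 * K * L := (le_div_iff₀ hn0).1 hδ2
  have hE : 1 / 2 ≤ 2 * δ * (3 * L) * N := by
    have : 1 ≤ δ * N := by nlinarith
    nlinarith
  have hB : (#V : ℝ) ≤ 2 * K * n ^ 2 * N := by
    have h1 : (#V : ℝ) ≤ 2 * n * t ^ (n - 1) := by exact_mod_cast hV
    have h2 : 2 * n * (t : ℝ) ^ (n - 1) ≤ 2 * n * (n * N) := by gcongr
    have h3 : 0 ≤ (n : ℝ) ^ 2 * N := by positivity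
    nlinarith
  have hΛB : 2 * K * n ^ 2 ≤ 2 * δ * (3 * L) * n ^ 3 := by
    have h1 : K ≤ 3 * (δ * n) * L := by nlinarith
    have h2 : 0 ≤ (n : ℝ) ^ 2 := by positivity
    nlinarith
  have hB1 : 2 * δ * (3 * L) ≤ 2 * K * n ^ 2 := by
    refine le_of_mul_le_mul_right ?_ hn0
    calc 2 * δ * (3 * L) * n = 6 * L * (δ * n) := by ring
      _ ≤ 6 * L * (2 * K * L) := by gcongr
      _ = 12 * K * (L * L) := by ring
      _ ≤ 12 * K * (n * n) := by gcongr
      _ = K * (n * n) * 12 := by ring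
      _ ≤ K * (n * n) * (2 * n) := by gcongr; linarith
      _ = 2 * K * n ^ 2 * n := by ring
  have h := logb_antichainCount_le hN0 hδ0 (by positivity : 0 < 3 * L) hE
    (fun F hF hne => middlePoints_exists_many_above ht (by omega) (hF.trans hVm) hne) hB
    (hpow ▸ hΛB) hB1
  refine h.trans ?_
  have hln : Real.log (2 * K * n ^ 2 / (2 * δ * (3 * L))) ≤ 3 * L := by
    calc Real.log (2 * K * n ^ 2 / (2 * δ * (3 * L))) ≤ Real.log ((n : ℝ) ^ 3) := by
          refine Real.log_le_log (by positivity) ?_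
          rw [div_le_iff₀ (by positivity), mul_comm ((n : ℝ) ^ 3)]
          exact hΛB
      _ = 3 * Real.log n := by rw [Real.log_pow]; norm_num
      _ ≤ 3 * L := by linarith
  calc N + 2 * δ * (3 * L) * N * (3 + 2 * Real.log (2 * K * n ^ 2 / (2 * δ * (3 * L))))
      ≤ N + 2 * δ * (3 * L) * N * (9 * L) := by gcongr; linarith
    _ = N + 54 * L ^ 2 * N * δ := by ring
    _ ≤ N + 54 * L ^ 2 * N * (2 * K * L / n) := by gcongr
    _ = (1 + 108 * K * L ^ 3 / n) * N := by ring

theorem logb_antichainCount_coarseRegion_le (ht : 2 ≤ t) (hn : 64 ≤ n)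
    (C : Finset (Fin n → Fin ((t + 1) / 2))) :
    Real.logb 2 (antichainCount (coarseRegion (t := t) C)) ≤
      8 * 4096 ^ 2 * (t ^ (n - 1) / (n : ℝ) ^ 2) +
        (1 + 108 * flowConst * Real.logb 2 n ^ 3 / n) * maxLayer t n := by
  classical
  set V := coarseRegion (t := t) C
  have hV : V ⊆ (middlePoints t n)ᶜ ∪ V ∩ middlePoints t n := fun x hx => by
    by_cases h : x ∈ middlePoints t n <;> simp [h, hx]
  have h1 : (antichainCount V : ℝ) ≤
      antichainCount (middlePoints t n)ᶜ * antichainCount (V ∩ middlePoints t n) := by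
    exact_mod_cast (antichainCount_mono hV).trans (antichainCount_union_le _ _)
  have hpos : ∀ F : Finset (Fin n → Fin t), (0 : ℝ) < antichainCount F := fun F => by
    exact_mod_cast antichainCount_pos F
  refine (Real.logb_le_logb_of_le one_lt_two (hpos V) h1).trans ?_
  rw [Real.logb_mul (hpos _).ne' (hpos _).ne']
  exact add_le_add (logb_antichainCount_compl_middle_le (by omega) hn)
    (logb_antichainCount_inter_middle_le ht hn inter_subset_right
      ((card_le_card inter_subset_left).trans (card_coarseRegion_le (by omega) C)))

theorem logb_antichainCount_univ_le_of_large (ht : 2 ≤ t) (hn : 64 ≤ n) :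
    Real.logb 2 (antichainCount (univ : Finset (Fin n → Fin t))) ≤
      (2 + 8 * 4096 ^ 2) * (t ^ (n - 1) / (n : ℝ) ^ 2) +
        (1 + 108 * flowConst * Real.logb 2 n ^ 3 / n) * maxLayer t n := by
  obtain ⟨C, hC⟩ := Finite.exists_max fun C : Finset (Fin n → Fin ((t + 1) / 2)) =>
    antichainCount (coarseRegion (t := t) C)
  have h1 : (antichainCount (univ : Finset (Fin n → Fin t)) : ℝ) ≤
      antichainCount (univ : Finset (Fin n → Fin ((t + 1) / 2))) *
        antichainCount (coarseRegion (t := t) C) := by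
    exact_mod_cast antichainCount_univ_le_mul (by omega) hC
  have hpos : ∀ {s : ℕ} (F : Finset (Fin n → Fin s)), (0 : ℝ) < antichainCount F := fun F => by
    exact_mod_cast antichainCount_pos F
  refine (Real.logb_le_logb_of_le one_lt_two (hpos _) h1).trans ?_
  rw [Real.logb_mul (hpos _).ne' (hpos _).ne']
  have h2 := logb_antichainCount_univ_le ((t + 1) / 2) (by omega : 2 ≤ n)
  have h3 := half_pow_pred_le ht hn
  have h4 := logb_antichainCount_coarseRegion_le ht hn C
  linarith

end Final

/-- The Falgas-Ravry–Räty–Tomon theorem on antichains in `[t]^n`. -/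
theorem stmt16 :
    ∃ c : ℝ, 0 < c ∧ ∀ n t : ℕ, 2 ≤ n → 2 ≤ t →
      Real.logb 2 (alphaT t n) ≤
        (1 + c * (Real.logb 2 n) ^ 3 / n) * (maxLayer t n : ℝ) := by
  have hK := one_le_flowConst
  refine ⟨108 * flowConst + (2 + 8 * 4096 ^ 2), by positivity, fun n t hn ht => ?_⟩
  rw [alphaT_eq_antichainCount]
  have hnR : (2 : ℝ) ≤ n := by exact_mod_cast hn
  have hn0 : (0 : ℝ) < n := by linarith
  set N : ℝ := (maxLayer t n : ℝ)
  set L := Real.logb 2 n with hL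
  have hL1 : 1 ≤ L := by
    rw [hL, Real.le_logb_iff_rpow_le one_lt_two hn0]
    simpa using hnR
  have hL3 : 1 ≤ L ^ 3 := one_le_pow₀ hL1
  have hN0 : 0 ≤ N := Nat.cast_nonneg _
  have hpN : (t : ℝ) ^ (n - 1) ≤ n * N :=
    pow_pred_le_mul_maxLayer (by omega) (by omega)
  rcases lt_or_ge n 64 with hlt | hge
  · refine (logb_antichainCount_univ_le t hn).trans ?_
    have hnlt : (n : ℝ) ≤ 64 := by exact_mod_cast hlt.le
    have h1 : (2 * n : ℝ) ≤ (108 * flowConst + (2 + 8 * 4096 ^ 2)) * L ^ 3 / n := by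
      rw [le_div_iff₀ hn0]
      nlinarith
    nlinarith
  · refine (logb_antichainCount_univ_le_of_large ht hge).trans ?_
    have h1 : (t : ℝ) ^ (n - 1) / (n : ℝ) ^ 2 ≤ L ^ 3 / n * N := by
      rw [div_le_iff₀ (by positivity)]
      calc (t : ℝ) ^ (n - 1) ≤ 1 * (n * N) := by linarith
        _ ≤ L ^ 3 * (n * N) := by gcongr
        _ = L ^ 3 / n * N * n ^ 2 := by field_simp
    calc _ ≤ (2 + 8 * 4096 ^ 2) * (L ^ 3 / n * N) + (1 + 108 * flowConst * L ^ 3 / n) * N := by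
          gcongr
      _ = _ := by ring
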